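/- Fix c > 0 and η ∈ [0,1) with c < c̄(η). Let p : ℕ → (0,1) be any sequence with √n·p(n) → c. Then for every ε > 0, lim_{n→∞} P_{p(n)}( |MC(G) − 1/2| > ε | X ≤ η·E X ) = 0, where MC(G) denotes the fraction of edges of G in a maximum cut. -/

import Mathlib

open Filter
open scoped BigOperators symmDiff Classical

noncomputable section

/-- Number of edges of a labeled simple graph on `Fin n`. -/
def edgeCount {n : ℕ} (G : SimpleGraph (Fin n)) : ℕ := Nat.card G.edgeSet

/-- Number of triangles of a labeled simple graph on `Fin n`. -/
def triCount {n : ℕ} (G : SimpleGraph (Fin n)) : ℕ :=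
  Nat.card {s : Finset (Fin n) // G.IsNClique 3 s}

/-- Probability of the event `A` under the Erdős–Rényi random graph `G(n,p)`. -/
def erProb (n : ℕ) (p : ℝ) (A : Set (SimpleGraph (Fin n))) : ℝ :=
  ∑ G : SimpleGraph (Fin n),
    if G ∈ A then p ^ edgeCount G * (1 - p) ^ (n.choose 2 - edgeCount G) else 0

/-- Conditional probability `P_p(A | B)` for `G(n,p)`. -/
def erCondProb (n : ℕ) (p : ℝ) (A B : Set (SimpleGraph (Fin n))) : ℝ :=
  erProb n p (A ∩ B) / erProb n p B

/-- Probability of the event `A` under the uniform random graph `G(n,m)`. -/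
def gnmProb (n m : ℕ) (A : Set (SimpleGraph (Fin n))) : ℝ :=
  (Nat.card {G : SimpleGraph (Fin n) // edgeCount G = m ∧ G ∈ A} : ℝ) /
    ((n.choose 2).choose m : ℝ)

/-- Expected number of triangles of `G(n,m)`. -/
def gnmExpTri (n m : ℕ) : ℝ :=
  (∑ G : SimpleGraph (Fin n), if edgeCount G = m then (triCount G : ℝ) else 0) /
    ((n.choose 2).choose m : ℝ)

/-- Gibbs weight `λ^{|G|} (1-ζ)^{X(G)}`. -/
def gibbsWeight {n : ℕ} (lam zeta : ℝ) (G : SimpleGraph (Fin n)) : ℝ :=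
  lam ^ edgeCount G * (1 - zeta) ^ triCount G

/-- The partition function `Z(λ,ζ)`. -/
def Zfun (n : ℕ) (lam zeta : ℝ) : ℝ := ∑ G : SimpleGraph (Fin n), gibbsWeight lam zeta G

/-- Probability of the event `A` under the Gibbs measure `μ_{λ,ζ}`. -/
def gibbsProb (n : ℕ) (lam zeta : ℝ) (A : Set (SimpleGraph (Fin n))) : ℝ :=
  (∑ G : SimpleGraph (Fin n), if G ∈ A then gibbsWeight lam zeta G else 0) / Zfun n lam zeta

/-- Expectation of `f` under the Gibbs measure `μ_{λ,ζ}`. -/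
def gibbsExp (n : ℕ) (lam zeta : ℝ) (f : SimpleGraph (Fin n) → ℝ) : ℝ :=
  (∑ G : SimpleGraph (Fin n), f G * gibbsWeight lam zeta G) / Zfun n lam zeta

/-- Number of edges of `H` with both endpoints in `S`. -/
def edgesIn {V : Type*} (H : SimpleGraph V) (S : Finset V) : ℕ :=
  Nat.card {e : Sym2 V // e ∈ H.edgeSet ∧ ∀ v ∈ e, v ∈ S}

/-- Weight `λ^{|S|} (1-ζ)^{|E(S)|}` of the measure `ν_{H,λ,ζ}`. -/
def nuWeight {V : Type*} (H : SimpleGraph V) (lam zeta : ℝ) (S : Finset V) : ℝ :=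
  lam ^ S.card * (1 - zeta) ^ edgesIn H S

/-- The partition function `Ξ_H(λ,ζ)`. -/
def XiFun {V : Type*} [Fintype V] (H : SimpleGraph V) (lam zeta : ℝ) : ℝ :=
  ∑ S : Finset V, nuWeight H lam zeta S

/-- The probability of `S` under `ν_{H,λ,ζ}`. -/
def nuProb {V : Type*} [Fintype V] (H : SimpleGraph V) (lam zeta : ℝ) (S : Finset V) : ℝ :=
  nuWeight H lam zeta S / XiFun H lam zeta

/-- `W` is the Lambert-W function on `[0,∞)`: for `x ≥ 0`, `W x` is the unique `w ≥ 0`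
with `w·e^w = x`. -/
def IsLambertW (W : ℝ → ℝ) : Prop :=
  ∀ x : ℝ, 0 ≤ x → (0 ≤ W x ∧ W x * Real.exp (W x) = x ∧
    ∀ w : ℝ, 0 ≤ w → w * Real.exp w = x → w = W x)

/-- `η* = (W(2/e)/(2/e))^{3/2}`. -/
def etaStar (W : ℝ → ℝ) : ℝ := (W (2 / Real.exp 1) / (2 / Real.exp 1)) ^ ((3 : ℝ) / 2)

/-- The condition `c < c̄(η)` where `c̄(η) = 1/√(e(1−η/η*))` for `η < η*` and `+∞` otherwise. -/
def LtCbar (W : ℝ → ℝ) (c η : ℝ) : Prop :=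
  η < etaStar W → c < 1 / Real.sqrt (Real.exp 1 * (1 - η / etaStar W))

/-- The left-hand side of the equation defining `ζ(c,η)`, interpreted as `1` at `ζ = 0`. -/
def zetaLHS (W : ℝ → ℝ) (c zeta : ℝ) : ℝ :=
  (1 - zeta) * (if zeta = 0 then 1 else
    (W (2 * zeta * c ^ 2) / (2 * zeta * c ^ 2)) ^ ((3 : ℝ) / 2))



/-- The number of edges of `G` crossing the cut `(S, Sᶜ)` (each edge counted once, via its
endpoint in `S` listed first). -/
def cutSize {n : ℕ} (G : SimpleGraph (Fin n)) (S : Finset (Fin n)) : ℕ :=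
  Nat.card {q : Fin n × Fin n // q.1 ∈ S ∧ q.2 ∉ S ∧ G.Adj q.1 q.2}

/-- The fraction of edges of `G` in a maximum cut (`0` if `G` has no edges). -/
def maxCutFrac {n : ℕ} (G : SimpleGraph (Fin n)) : ℝ :=
  if edgeCount G = 0 then 0
  else ((Finset.univ.sup (fun S : Finset (Fin n) => cutSize G S) : ℕ) : ℝ) / (edgeCount G : ℝ)

section TriangleGas

variable {E : Type*} [Fintype E] [DecidableEq E]

/-- Partition function of the lattice gas on `E` with activities `Λ` and a penalty `r` for every
fully occupied member of `T`, where the elements of `F` are occupied by fiat. -/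
def partFun (Λ : E → ℝ) (r : ℝ) (F : Finset E) (T : Finset (Finset E)) : ℝ :=
  ∑ A ∈ Fᶜ.powerset, (∏ e ∈ A, Λ e) * r ^ (T.filter (· ⊆ A ∪ F)).card

/-- Probability that `e` is occupied, given that `F` is. -/
def occ (Λ : E → ℝ) (r : ℝ) (F : Finset E) (T : Finset (Finset E)) (e : E) : ℝ :=
  Λ e * partFun Λ r (insert e F) T / partFun Λ r F T

variable {Λ : E → ℝ} {r : ℝ}

lemma partFun_nonneg (hΛ : ∀ e, 0 ≤ Λ e) (hr : 0 ≤ r) (F : Finset E) (T : Finset (Finset E)) :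
    0 ≤ partFun Λ r F T :=
  Finset.sum_nonneg fun _ _ => mul_nonneg (Finset.prod_nonneg fun e _ => hΛ e) (pow_nonneg hr _)

lemma partFun_anti (hΛ : ∀ e, 0 ≤ Λ e) (hr : 0 ≤ r) (hr1 : r ≤ 1) {F F' : Finset E}
    (h : F ⊆ F') (T : Finset (Finset E)) : partFun Λ r F' T ≤ partFun Λ r F T := by
  unfold partFun
  refine le_trans (Finset.sum_le_sum (g := fun A => (∏ e ∈ A, Λ e) *
    r ^ (T.filter (· ⊆ A ∪ F)).card) fun _ _ => ?_) ?_
  · refine mul_le_mul_of_nonneg_left ?_ (Finset.prod_nonneg fun e _ => hΛ e)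
    refine pow_le_pow_of_le_one hr hr1 (Finset.card_le_card ?_)
    intro t ht
    rw [Finset.mem_filter] at ht ⊢
    exact ⟨ht.1, ht.2.trans (Finset.union_subset_union_right h)⟩
  · refine Finset.sum_le_sum_of_subset_of_nonneg ?_ fun A _ _ =>
      mul_nonneg (Finset.prod_nonneg fun e _ => hΛ e) (pow_nonneg hr _)
    exact Finset.powerset_mono.2 (Finset.compl_subset_compl.2 h)

lemma one_le_partFun (hΛ : ∀ e, 0 ≤ Λ e) (hr : 0 ≤ r) {F : Finset E} {T : Finset (Finset E)}
    (h : ∀ t ∈ T, ¬ t ⊆ F) : 1 ≤ partFun Λ r F T := by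
  unfold partFun
  have h0 : T.filter (· ⊆ ∅ ∪ F) = ∅ := by
    rw [Finset.filter_eq_empty_iff]
    intro t ht
    simpa using h t ht
  have := Finset.single_le_sum (f := fun A => (∏ e ∈ A, Λ e) * r ^ (T.filter (· ⊆ A ∪ F)).card)
    (s := Fᶜ.powerset) (fun A _ => mul_nonneg (Finset.prod_nonneg fun e _ => hΛ e)
      (pow_nonneg hr _)) (Finset.empty_mem_powerset _)
  simpa only [h0, Finset.prod_empty, Finset.card_empty, pow_zero, mul_one] using this

lemma partFun_split {F : Finset E} {e : E} (he : e ∉ F) (T : Finset (Finset E)) :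
    partFun Λ r F T =
      partFun Λ r (insert e F) (T.filter (e ∉ ·)) + Λ e * partFun Λ r (insert e F) T := by
  have h1 : Fᶜ = insert e (insert e F)ᶜ := by
    ext a
    by_cases ha : a = e <;> simp [ha, he]
  have h2 : e ∉ (insert e F)ᶜ := by simp
  unfold partFun
  rw [h1, Finset.sum_powerset_insert h2, Finset.mul_sum]
  congr 1
  · refine Finset.sum_congr rfl fun A hA => ?_
    have heA : e ∉ A := fun h => h2 (Finset.mem_powerset.1 hA h)
    congr 3
    ext t
    simp only [Finset.mem_filter, and_assoc]
    refine and_congr_right fun _ => ⟨fun h => ⟨fun het => ?_, h.trans ?_⟩, fun h a ha => ?_⟩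
    · have := h het
      simp [heA, he] at this
    · exact Finset.union_subset_union_right (Finset.subset_insert _ _)
    · have := h.2 ha
      have hae : a ≠ e := fun h' => h.1 (h' ▸ ha)
      simpa [hae] using this
  · refine Finset.sum_congr rfl fun A hA => ?_
    have heA : e ∉ A := fun h => h2 (Finset.mem_powerset.1 hA h)
    rw [Finset.prod_insert heA, mul_assoc, Finset.insert_union, Finset.union_insert]

lemma sum_superset {F D : Finset E} (hD : Disjoint D F) (T : Finset (Finset E)) :
    ∑ A ∈ Fᶜ.powerset with D ⊆ A, (∏ e ∈ A, Λ e) * r ^ (T.filter (· ⊆ A ∪ F)).card =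
      (∏ e ∈ D, Λ e) * partFun Λ r (F ∪ D) T := by
  unfold partFun
  rw [Finset.mul_sum]
  symm
  refine Finset.sum_bij' (fun A _ => A ∪ D) (fun A _ => A \ D) ?_ ?_ ?_ ?_ ?_
  · intro A hA
    simp only [Finset.mem_powerset, Finset.mem_filter] at hA ⊢
    refine ⟨Finset.union_subset (hA.trans ?_) ?_, Finset.subset_union_right⟩
    · exact Finset.compl_subset_compl.2 Finset.subset_union_left
    · rwa [Finset.subset_compl_iff_disjoint_right]
  · intro A hA
    simp only [Finset.mem_powerset, Finset.mem_filter] at hA ⊢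
    intro a ha
    have := hA.1 (Finset.mem_sdiff.1 ha).1
    simp only [Finset.mem_compl, Finset.mem_union, Finset.mem_sdiff] at this ha ⊢
    tauto
  · intro A hA
    have hAD : Disjoint A D := by
      rw [← Finset.subset_compl_iff_disjoint_right]
      exact (Finset.mem_powerset.1 hA).trans
        (Finset.compl_subset_compl.2 Finset.subset_union_right)
    rw [Finset.union_sdiff_right, Finset.sdiff_eq_self_of_disjoint hAD]
  · intro A hA
    exact Finset.sdiff_union_of_subset (Finset.mem_filter.1 hA).2
  · intro A hA
    have hAD : Disjoint A D := by
      rw [← Finset.subset_compl_iff_disjoint_right]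
      exact (Finset.mem_powerset.1 hA).trans
        (Finset.compl_subset_compl.2 Finset.subset_union_right)
    rw [Finset.prod_union hAD, ← mul_assoc, mul_comm (∏ e ∈ D, Λ e), Finset.union_assoc,
      Finset.union_comm D F]

lemma partFun_insert (F : Finset E) {t : Finset E} {T : Finset (Finset E)} (ht : t ∉ T) :
    partFun Λ r F (insert t T) =
      partFun Λ r F T - (1 - r) * ((∏ e ∈ t \ F, Λ e) * partFun Λ r (F ∪ t) T) := by
  have h := sum_superset (Λ := Λ) (r := r) (F := F) (D := t \ F) Finset.sdiff_disjoint T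
  rw [Finset.union_sdiff_self_eq_union] at h
  rw [← h, Finset.sum_filter, Finset.mul_sum]
  unfold partFun
  rw [← Finset.sum_sub_distrib]
  refine Finset.sum_congr rfl fun A hA => ?_
  have hiff : t ⊆ A ∪ F ↔ t \ F ⊆ A := by
    rw [Finset.union_comm]
    exact sdiff_le_iff.symm
  rw [Finset.filter_insert]
  by_cases hA' : t \ F ⊆ A
  · rw [if_pos hA', if_pos (hiff.2 hA'), Finset.card_insert_of_notMem (by simp [ht]), pow_succ]
    ring
  · rw [if_neg hA', if_neg (fun h => hA' (hiff.1 h))]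
    ring

lemma occ_nonneg (hΛ : ∀ e, 0 ≤ Λ e) (hr : 0 ≤ r) (F : Finset E) (T : Finset (Finset E)) (e : E) :
    0 ≤ occ Λ r F T e :=
  div_nonneg (mul_nonneg (hΛ e) (partFun_nonneg hΛ hr _ _)) (partFun_nonneg hΛ hr _ _)

lemma occ_le (hΛ : ∀ e, 0 ≤ Λ e) (hr : 0 ≤ r) (hr1 : r ≤ 1) (F : Finset E)
    (T : Finset (Finset E)) (e : E) : occ Λ r F T e ≤ Λ e := by
  unfold occ
  refine div_le_of_le_mul₀ (partFun_nonneg hΛ hr _ _) (hΛ e) ?_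
  exact mul_le_mul_of_nonneg_left (partFun_anti hΛ hr hr1 (Finset.subset_insert _ _) T) (hΛ e)

/-- A linear `3`-uniform hypergraph in which every vertex has degree `d`. -/
structure IsLinearTriple (H : Finset (Finset E)) (d : ℕ) : Prop where
  card_eq : ∀ t ∈ H, t.card = 3
  linear : ∀ s ∈ H, ∀ t ∈ H, ∀ a b, a ≠ b → a ∈ s → b ∈ s → a ∈ t → b ∈ t → s = t
  degree : ∀ e, (H.filter (e ∈ ·)).card = d

/-- `T` is a subfamily of `H` omitting only members that meet `F`, and occupying `e` on top of `F`
does not complete any member of `T`. -/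
structure Admissible (H : Finset (Finset E)) (F : Finset E) (T : Finset (Finset E)) (e : E) :
    Prop where
  subset : T ⊆ H
  mem_of_disjoint : ∀ t ∈ H, Disjoint t F → t ∈ T
  notMem : e ∉ F
  not_subset : ∀ t ∈ T, ¬ t ⊆ insert e F

/-- A member `t ∋ e` that does not interact with `F`, even after `t` is occupied. -/
def IsClean (H : Finset (Finset E)) (F : Finset E) (e : E) (t : Finset E) : Prop :=
  Disjoint t F ∧ ∀ s ∈ H, s ⊆ F ∪ t → s ≠ t → Disjoint s (t.erase e)

lemma card_completions_le {H : Finset (Finset E)} {d : ℕ} (hH : IsLinearTriple H d)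
    (F : Finset E) :
    (Finset.univ.filter fun f => ∃ s ∈ H, f ∈ s ∧ s.erase f ⊆ F).card ≤ 2 ^ F.card := by
  rw [← Finset.card_powerset]
  choose! s hs using fun (f : E) (hf : ∃ s ∈ H, f ∈ s ∧ s.erase f ⊆ F) => hf
  refine Finset.card_le_card_of_injOn (fun f => (s f).erase f) ?_ ?_
  · intro f hf
    exact Finset.mem_powerset.2 (hs f (Finset.mem_filter.1 hf).2).2.2
  · intro f hf g hg hfg
    have hf' := hs f (Finset.mem_filter.1 hf).2
    have hg' := hs g (Finset.mem_filter.1 hg).2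
    simp only at hfg
    have hc : 1 < ((s f).erase f).card := by
      rw [Finset.card_erase_of_mem hf'.2.1, hH.card_eq _ hf'.1]
      norm_num
    obtain ⟨a, ha, b, hb, hab⟩ := Finset.one_lt_card.1 hc
    have hst : s f = s g := hH.linear _ hf'.1 _ hg'.1 a b hab (Finset.mem_of_mem_erase ha)
      (Finset.mem_of_mem_erase hb) (Finset.mem_of_mem_erase (hfg ▸ ha))
      (Finset.mem_of_mem_erase (hfg ▸ hb))
    by_contra hne
    have h1 : f ∈ (s g).erase g := Finset.mem_erase.2 ⟨hne, hst ▸ hf'.2.1⟩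
    rw [← hfg] at h1
    simp at h1

lemma card_not_isClean_le {H : Finset (Finset E)} {d : ℕ} (hH : IsLinearTriple H d)
    {F : Finset E} {e : E} (he : e ∉ F) :
    (H.filter fun t => e ∈ t ∧ ¬ IsClean H F e t).card ≤ F.card + 2 ^ F.card := by
  set C := Finset.univ.filter fun f => ∃ s ∈ H, f ∈ s ∧ s.erase f ⊆ F with hC
  have key : ∀ t ∈ H, e ∈ t ∧ ¬ IsClean H F e t → ∃ f, f ∈ t ∧ f ≠ e ∧ f ∈ F ∪ C := by
    rintro t ht ⟨het, hcl⟩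
    by_cases hd : Disjoint t F
    · have : ∃ s ∈ H, s ⊆ F ∪ t ∧ s ≠ t ∧ ¬ Disjoint s (t.erase e) := by
        by_contra hcon
        push Not at hcon
        exact hcl ⟨hd, hcon⟩
      obtain ⟨s, hs, hsF, hst, hdis⟩ := this
      obtain ⟨f, hfs, hft⟩ := Finset.not_disjoint_iff.1 hdis
      refine ⟨f, Finset.mem_of_mem_erase hft, Finset.ne_of_mem_erase hft,
        Finset.mem_union_right _ ?_⟩
      rw [hC, Finset.mem_filter]
      refine ⟨Finset.mem_univ _, s, hs, hfs, fun y hy => ?_⟩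
      rcases Finset.mem_union.1 (hsF (Finset.mem_of_mem_erase hy)) with h | h
      · exact h
      · exact absurd (hH.linear s hs t ht y f (Finset.ne_of_mem_erase hy)
          (Finset.mem_of_mem_erase hy) hfs h (Finset.mem_of_mem_erase hft)) hst
    · obtain ⟨f, hft, hfF⟩ := Finset.not_disjoint_iff.1 hd
      exact ⟨f, hft, fun h => he (h ▸ hfF), Finset.mem_union_left _ hfF⟩
  have : Nonempty E := ⟨e⟩
  choose! φ hφ using key
  have hle : (H.filter fun t => e ∈ t ∧ ¬ IsClean H F e t).card ≤ (F ∪ C).card := by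
    refine Finset.card_le_card_of_injOn φ ?_ ?_
    · intro t ht
      have ht' := Finset.mem_filter.1 ht
      exact (hφ t ht'.1 ht'.2).2.2
    · intro s hs t ht hst
      have hs' := Finset.mem_filter.1 hs
      have ht' := Finset.mem_filter.1 ht
      have h1 := hφ s hs'.1 hs'.2
      have h2 := hφ t ht'.1 ht'.2
      exact hH.linear s hs'.1 t ht'.1 (φ s) e h1.2.1 h1.1 hs'.2.1 (hst ▸ h2.1) ht'.2.1
  exact hle.trans ((Finset.card_union_le _ _).trans
    (Nat.add_le_add_left (card_completions_le hH F) _))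

lemma partFun_insert_isClean (hΛ : ∀ e, 0 ≤ Λ e) (hr : 0 ≤ r) {H : Finset (Finset E)} {d : ℕ}
    (hH : IsLinearTriple H d) {F : Finset E} {T U : Finset (Finset E)} {e : E}
    (hA : Admissible H F T e) (hUT : U ⊆ T) (hU : T.filter (e ∉ ·) ⊆ U) {t : Finset E}
    (ht : t ∈ T) (het : e ∈ t) (htU : t ∉ U) (hcl : IsClean H F e t) :
    ∃ f g, Admissible H (insert e F) U f ∧ Admissible H (insert f (insert e F)) U g ∧
      partFun Λ r (insert e F) (insert t U) = partFun Λ r (insert e F) U *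
        (1 - (1 - r) * (occ Λ r (insert e F) U f * occ Λ r (insert f (insert e F)) U g)) := by
  have hc : (t.erase e).card = 2 := by
    rw [Finset.card_erase_of_mem het, hH.card_eq t (hA.subset ht)]
  obtain ⟨f, g, hfg, hteq⟩ := Finset.card_eq_two.1 hc
  have hf : f ∈ t.erase e := by simp [hteq]
  have hg : g ∈ t.erase e := by simp [hteq]
  have htt : t = insert e {f, g} := by rw [← hteq, Finset.insert_erase het]
  have hfF : f ∉ F := Finset.disjoint_left.1 hcl.1 (Finset.mem_of_mem_erase hf)
  have hgF : g ∉ F := Finset.disjoint_left.1 hcl.1 (Finset.mem_of_mem_erase hg)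
  have hfe := Finset.ne_of_mem_erase hf
  have hge := Finset.ne_of_mem_erase hg
  have hns : ∀ s ∈ U, ¬ s ⊆ F ∪ t := by
    intro s hs hsub
    have hdis := hcl.2 s (hA.subset (hUT hs)) hsub (fun h => htU (h ▸ hs))
    refine hA.not_subset s (hUT hs) fun a ha => ?_
    have h1 := hsub ha
    have h2 := Finset.disjoint_left.1 hdis ha
    rw [Finset.mem_erase] at h2
    rw [Finset.mem_union] at h1
    rw [Finset.mem_insert]
    tauto
  have hmem : ∀ s ∈ H, Disjoint s (insert e F) → s ∈ U := by
    intro s hs hd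
    rw [Finset.disjoint_insert_right] at hd
    exact hU (Finset.mem_filter.2 ⟨hA.mem_of_disjoint s hs hd.2, hd.1⟩)
  have hA1 : Admissible H (insert e F) U f := by
    refine ⟨hUT.trans hA.subset, hmem, by simp [hfe, hfF], fun s hs hsub => hns s hs
      (hsub.trans fun a ha => ?_)⟩
    simp only [htt, Finset.mem_insert, Finset.mem_union, Finset.mem_singleton] at ha ⊢
    tauto
  have hA2 : Admissible H (insert f (insert e F)) U g := by
    refine ⟨hUT.trans hA.subset, fun s hs hd => hmem s hs ?_, by simp [hge, hgF, hfg.symm],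
      fun s hs hsub => hns s hs (hsub.trans fun a ha => ?_)⟩
    · rw [Finset.disjoint_insert_right] at hd
      exact hd.2
    · simp only [htt, Finset.mem_insert, Finset.mem_union, Finset.mem_singleton] at ha ⊢
      tauto
  refine ⟨f, g, hA1, hA2, ?_⟩
  have hp1 : partFun Λ r (insert e F) U ≠ 0 := by
    have := one_le_partFun (Λ := Λ) hΛ hr (F := insert e F) (T := U)
      fun s hs => hA.not_subset s (hUT hs)
    linarith
  have hp2 : partFun Λ r (insert f (insert e F)) U ≠ 0 := by
    have := one_le_partFun (Λ := Λ) hΛ hr (F := insert f (insert e F)) (T := U) hA1.not_subset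
    linarith
  have hsd : t \ insert e F = {f, g} := by
    ext a
    simp only [htt, Finset.mem_sdiff, Finset.mem_insert, Finset.mem_singleton]
    constructor
    · tauto
    · rintro (rfl | rfl) <;> tauto
  have hun : insert e F ∪ t = insert g (insert f (insert e F)) := by
    ext a
    simp only [htt, Finset.mem_union, Finset.mem_insert, Finset.mem_singleton]
    tauto
  rw [partFun_insert _ htU, hsd, hun, Finset.prod_pair hfg, occ, occ]
  field_simp

/-- Adding back, one at a time, the members of `T` through `e`. -/
lemma partFun_ratio_bounds (hΛ : ∀ e, 0 ≤ Λ e) (hr : 0 ≤ r) (hr1 : r ≤ 1)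
    {H : Finset (Finset E)} {d : ℕ} (hH : IsLinearTriple H d) {F : Finset E}
    {T : Finset (Finset E)} {e : E} (hA : Admissible H F T e) {l a b : ℝ} (hl : ∀ e, Λ e ≤ l)
    (hl1 : l ≤ 1) (hb0 : 0 ≤ b) (hb1 : b ≤ 1) (ha0 : 0 ≤ a) (ha1 : a ≤ 1)
    (hJ : ∀ U f g, Admissible H (insert e F) U f → Admissible H (insert f (insert e F)) U g →
      a ≤ occ Λ r (insert e F) U f * occ Λ r (insert f (insert e F)) U g ∧
      occ Λ r (insert e F) U f * occ Λ r (insert f (insert e F)) U g ≤ b)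
    (S : Finset (Finset E)) (hS : S ⊆ T.filter (e ∈ ·)) :
    partFun Λ r (insert e F) (T.filter (e ∉ ·)) *
        ((1 - (1 - r) * b) ^ S.card * (1 - l) ^ (S.filter fun t => ¬ IsClean H F e t).card) ≤
      partFun Λ r (insert e F) (T.filter (e ∉ ·) ∪ S) ∧
    partFun Λ r (insert e F) (T.filter (e ∉ ·) ∪ S) ≤
      partFun Λ r (insert e F) (T.filter (e ∉ ·)) *
        (1 - (1 - r) * a) ^ (S.filter (IsClean H F e)).card := by
  have hl0 : 0 ≤ l := (hΛ e).trans (hl e)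
  have hfb : 0 ≤ 1 - (1 - r) * b := by nlinarith
  have hfa : 0 ≤ 1 - (1 - r) * a := by nlinarith
  induction S using Finset.induction_on with
  | empty => simp
  | insert t S htS ih =>
    have hSsub : S ⊆ T.filter (e ∈ ·) := (Finset.subset_insert _ _).trans hS
    obtain ⟨ihl, ihu⟩ := ih hSsub
    have htT := Finset.mem_filter.1 (hS (Finset.mem_insert_self t S))
    set T' := T.filter (e ∉ ·) with hT'
    set U := T' ∪ S with hU
    have htU : t ∉ U := by
      rw [hU, Finset.mem_union, not_or]
      exact ⟨fun h => (Finset.mem_filter.1 h).2 htT.2, htS⟩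
    have hUT : U ⊆ T := Finset.union_subset (Finset.filter_subset _ _)
      (hSsub.trans (Finset.filter_subset _ _))
    have hUeq : T' ∪ insert t S = insert t U := by rw [Finset.union_insert]
    rw [hUeq]
    set P0 := partFun Λ r (insert e F) T' with hP0
    set P := partFun Λ r (insert e F) U with hP
    have hP0n : 0 ≤ P0 := partFun_nonneg hΛ hr _ _
    have hPn : 0 ≤ P := partFun_nonneg hΛ hr _ _
    rw [Finset.card_insert_of_notMem htS]
    have hLn : 0 ≤ P0 * ((1 - (1 - r) * b) ^ S.card *
        (1 - l) ^ (S.filter fun t => ¬ IsClean H F e t).card) :=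
      mul_nonneg hP0n (mul_nonneg (pow_nonneg hfb _) (pow_nonneg (by linarith) _))
    by_cases hcl : IsClean H F e t
    · obtain ⟨f, g, hf, hg, heq⟩ := partFun_insert_isClean (Λ := Λ) hΛ hr hH hA hUT
        Finset.subset_union_left htT.1 htT.2 htU hcl
      obtain ⟨hJ1, hJ2⟩ := hJ U f g hf hg
      rw [heq, Finset.filter_insert, if_neg (not_not.2 hcl), Finset.filter_insert, if_pos hcl,
        Finset.card_insert_of_notMem (by simp [htS])]
      set J := occ Λ r (insert e F) U f * occ Λ r (insert f (insert e F)) U g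
      constructor
      · calc
          _ = (P0 * ((1 - (1 - r) * b) ^ S.card *
              (1 - l) ^ (S.filter fun t => ¬ IsClean H F e t).card)) * (1 - (1 - r) * b) := by ring
          _ ≤ P * (1 - (1 - r) * J) := by
            refine mul_le_mul ihl ?_ hfb hPn
            nlinarith
      · calc
          _ ≤ (P0 * (1 - (1 - r) * a) ^ (S.filter (IsClean H F e)).card) *
              (1 - (1 - r) * a) := by
            refine mul_le_mul ihu ?_ ?_ (mul_nonneg hP0n (pow_nonneg hfa _)) <;> nlinarith
          _ = _ := by ring
    · rw [Finset.filter_insert, if_pos hcl, Finset.filter_insert, if_neg hcl,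
        Finset.card_insert_of_notMem (by simp [htS]), partFun_insert _ htU]
      set Q := (∏ e ∈ t \ insert e F, Λ e) * partFun Λ r (insert e F ∪ t) U with hQ
      have hQ0 : 0 ≤ Q := mul_nonneg (Finset.prod_nonneg fun e _ => hΛ e) (partFun_nonneg hΛ hr _ _)
      have hQl : Q ≤ l * P := by
        refine mul_le_mul ?_ (partFun_anti hΛ hr hr1 Finset.subset_union_left U)
          (partFun_nonneg hΛ hr _ _) hl0
        obtain ⟨y, hy⟩ : (t \ insert e F).Nonempty :=
          Finset.sdiff_nonempty.2 (hA.not_subset t htT.1)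
        rw [← Finset.mul_prod_erase _ _ hy]
        have : ∏ x ∈ (t \ insert e F).erase y, Λ x ≤ 1 :=
          Finset.prod_le_one (fun i _ => hΛ i) fun i _ => (hl i).trans hl1
        nlinarith [hl y, hΛ y, Finset.prod_nonneg (s := (t \ insert e F).erase y) fun i _ => hΛ i]
      constructor
      · calc
          _ ≤ (P0 * ((1 - (1 - r) * b) ^ S.card *
              (1 - l) ^ (S.filter fun t => ¬ IsClean H F e t).card)) * (1 - l) := by
            rw [pow_succ, pow_succ]
            have h1 : 1 - (1 - r) * b ≤ 1 := by nlinarith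
            calc _ = (P0 * ((1 - (1 - r) * b) ^ S.card *
              (1 - l) ^ (S.filter fun t => ¬ IsClean H F e t).card)) * (1 - l) *
                (1 - (1 - r) * b) := by ring
              _ ≤ _ := mul_le_of_le_one_right (mul_nonneg hLn (by linarith)) h1
          _ ≤ P * (1 - l) := mul_le_mul_of_nonneg_right ihl (by linarith)
          _ ≤ _ := by nlinarith
      · refine le_trans ?_ ihu
        nlinarith

end TriangleGas

lemma exp_neg_le_add {s w δ : ℝ} (hs : 0 ≤ s) (hδ : 0 ≤ δ) (h : w - s ≤ δ) :
    Real.exp (-s) ≤ Real.exp (-w) + δ := by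
  have h1 : Real.exp (-s) * Real.exp (-δ) ≤ Real.exp (-w) := by
    rw [← Real.exp_add]
    exact Real.exp_le_exp.2 (by linarith)
  have h2 : 1 - δ ≤ Real.exp (-δ) := by linarith [Real.add_one_le_exp (-δ)]
  have h3 : Real.exp (-s) ≤ 1 := Real.exp_le_one_iff.2 (by linarith)
  nlinarith [Real.exp_pos (-s)]

lemma one_sub_pow_le_exp {t : ℝ} (ht : t ≤ 1) (m : ℕ) : (1 - t) ^ m ≤ Real.exp (-(m * t)) := by
  calc (1 - t) ^ m ≤ (Real.exp (-t)) ^ m :=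
        pow_le_pow_left₀ (by linarith) (by linarith [Real.add_one_le_exp (-t)]) m
    _ = _ := by rw [← Real.exp_nat_mul]; ring_nf

lemma exp_le_one_sub_pow {t : ℝ} (ht : t ≤ 1 / 2) (m : ℕ) :
    Real.exp (-(m * (t + 2 * t ^ 2))) ≤ (1 - t) ^ m := by
  have h1 : Real.exp (-(t + 2 * t ^ 2)) ≤ 1 - t := by
    rw [Real.exp_neg]
    refine inv_le_of_inv_le₀ (by linarith) ?_
    refine le_trans ?_ (Real.add_one_le_exp _)
    rw [inv_le_iff_one_le_mul₀ (by linarith)]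
    nlinarith [mul_nonneg (sq_nonneg t) (by linarith : (0:ℝ) ≤ 1 - 2 * t)]
  calc _ = (Real.exp (-(t + 2 * t ^ 2))) ^ m := by rw [← Real.exp_nat_mul]; ring_nf
    _ ≤ _ := pow_le_pow_left₀ (Real.exp_pos _).le h1 m

lemma one_sub_div_pow_le {z y K N k : ℝ} {m : ℕ} (hz0 : 0 ≤ z) (hz1 : z ≤ 1) (hy0 : 0 ≤ y)
    (hyK : y ≤ K) (hN : 0 < N) (hyN : y / N ≤ 1) (hm : N - m ≤ k) (hk : 0 ≤ k) :
    (1 - z * (y / N)) ^ m ≤ Real.exp (-(z * y)) + K * k / N := by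
  have hyN0 : 0 ≤ y / N := by positivity
  have hK : 0 ≤ K := hy0.trans hyK
  refine (one_sub_pow_le_exp ?_ _).trans (exp_neg_le_add (by positivity) (by positivity) ?_)
  · nlinarith
  · have h1 : z * y - m * (z * (y / N)) = z * y * (N - m) / N := by field_simp
    rw [h1]
    refine div_le_div_of_nonneg_right ?_ hN.le
    have h2 : z * y ≤ K := by nlinarith
    have h3 : 0 ≤ z * y := by positivity
    calc _ ≤ z * y * k := mul_le_mul_of_nonneg_left hm h3
      _ ≤ _ := mul_le_mul_of_nonneg_right h2 hk

lemma le_one_sub_div_pow {z y K N : ℝ} {m : ℕ} (hz0 : 0 ≤ z) (hz1 : z ≤ 1) (hy0 : 0 ≤ y)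
    (hyK : y ≤ K) (hN : 0 < N) (hyN : y / N ≤ 1 / 2) (hm : m ≤ N) :
    Real.exp (-(z * y)) - 2 * K ^ 2 / N ≤ (1 - z * (y / N)) ^ m := by
  have hyN0 : 0 ≤ y / N := by positivity
  have ht2 : z * (y / N) ≤ 1 / 2 := by nlinarith
  have hK : 0 ≤ K := hy0.trans hyK
  rw [sub_le_iff_le_add]
  refine le_trans (exp_neg_le_add (w := m * (z * (y / N) + 2 * (z * (y / N)) ^ 2))
    (by positivity) (by positivity) ?_) (add_le_add_left (exp_le_one_sub_pow ht2 _) _)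
  have h1 : (m : ℝ) * (z * (y / N) + 2 * (z * (y / N)) ^ 2) ≤
      N * (z * (y / N) + 2 * (z * (y / N)) ^ 2) := mul_le_mul_of_nonneg_right hm (by positivity)
  have h2 : N * (z * (y / N) + 2 * (z * (y / N)) ^ 2) = z * y + 2 * (z * y) ^ 2 / N := by
    field_simp
  have h3 : 2 * (z * y) ^ 2 / N ≤ 2 * K ^ 2 / N := by
    have h4 : z * y ≤ K := by nlinarith
    gcongr
  linarith

section TriangleGas

variable {E : Type*} [Fintype E] [DecidableEq E] {Λ : E → ℝ} {r : ℝ}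

lemma occ_step_aux {h L ρ c C x y₁ y₂ z D κ v w : ℝ} (hh : 0 < h) (hL : 0 ≤ L)
    (hLC : h * L ≤ C) (hLc : |h * L - c| ≤ κ) (hc : 0 ≤ c) (hz0 : 0 ≤ z)
    (hx : x = c * Real.exp (-(z * x ^ 2)))
    (hC : 0 ≤ C) (hD : 0 ≤ D) (hy₁0 : 0 ≤ y₁) (hy₂0 : 0 ≤ y₂)
    (hy₁ : x ^ 2 - y₁ ≤ 2 * C * D) (hy₂ : y₂ - x ^ 2 ≤ 2 * C * D) (hv : 0 ≤ v) (hw : 0 ≤ w)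
    (hu : ρ ≤ Real.exp (-(z * y₁)) + v) (hl : Real.exp (-(z * y₂)) - w ≤ ρ) (hρ : 0 ≤ ρ)
    (hρ1 : ρ ≤ 1) :
    |h * (L * ρ / (1 + L * ρ)) - x| ≤ 2 * z * c * C * D + κ + C * v + C * w + C ^ 2 / h := by
  have hκ := abs_le.1 hLc
  have hLρ : 0 ≤ L * ρ := mul_nonneg hL hρ
  have e1 : Real.exp (-(z * y₁)) ≤ Real.exp (-(z * x ^ 2)) + z * (2 * C * D) :=
    exp_neg_le_add (mul_nonneg hz0 hy₁0) (by positivity) (by nlinarith)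
  have e2 : Real.exp (-(z * x ^ 2)) ≤ Real.exp (-(z * y₂)) + z * (2 * C * D) :=
    exp_neg_le_add (mul_nonneg hz0 (sq_nonneg x)) (by positivity) (by nlinarith)
  have e3 : Real.exp (-(z * y₁)) ≤ 1 := Real.exp_le_one_iff.2 (by nlinarith)
  have e4 : Real.exp (-(z * y₂)) ≤ 1 := Real.exp_le_one_iff.2 (by nlinarith)
  have hκ0 : 0 ≤ κ := (abs_nonneg _).trans hLc
  have p1 := Real.exp_pos (-(z * y₁))
  have p2 := Real.exp_pos (-(z * y₂))
  have hCh : 0 ≤ C ^ 2 / h := by positivity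
  have hLh : L ≤ C / h := by rw [le_div_iff₀ hh]; linarith
  have up : h * (L * ρ / (1 + L * ρ)) ≤ h * (L * ρ) :=
    mul_le_mul_of_nonneg_left (div_le_self hLρ (by linarith)) hh.le
  have lo : h * (L * ρ) - C ^ 2 / h ≤ h * (L * ρ / (1 + L * ρ)) := by
    have : L * ρ - (L * ρ) ^ 2 ≤ L * ρ / (1 + L * ρ) := by
      rw [le_div_iff₀ (by linarith)]
      nlinarith [pow_nonneg hLρ 3]
    have h2 : L * ρ ≤ C / h := le_trans (mul_le_of_le_one_right hL hρ1) hLh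
    have h3 : h * (L * ρ) ^ 2 ≤ C ^ 2 / h := by
      calc h * (L * ρ) ^ 2 ≤ h * (C / h) ^ 2 := by gcongr
        _ = _ := by field_simp
    nlinarith [mul_le_mul_of_nonneg_left this hh.le]
  have up2 : h * (L * ρ) ≤ x + 2 * z * c * C * D + κ + C * v := by
    have s1 : (h * L) * ρ ≤ (h * L) * (Real.exp (-(z * y₁)) + v) :=
      mul_le_mul_of_nonneg_left hu (by positivity)
    have s2 : (h * L - c) * Real.exp (-(z * y₁)) ≤ κ :=
      (mul_le_mul_of_nonneg_right hκ.2 p1.le).trans (mul_le_of_le_one_right hκ0 e3)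
    have s3 : h * L * v ≤ C * v := mul_le_mul_of_nonneg_right hLC hv
    have s4 := mul_le_mul_of_nonneg_left e1 hc
    linarith
  have lo2 : x - 2 * z * c * C * D - κ - C * w ≤ h * (L * ρ) := by
    have s1 : (h * L) * (Real.exp (-(z * y₂)) - w) ≤ (h * L) * ρ :=
      mul_le_mul_of_nonneg_left hl (by positivity)
    have s2 : (c - h * L) * Real.exp (-(z * y₂)) ≤ κ :=
      (mul_le_mul_of_nonneg_right (by linarith) p2.le).trans (mul_le_of_le_one_right hκ0 e4)
    have s3 : h * L * w ≤ C * w := mul_le_mul_of_nonneg_right hLC hw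
    have s4 := mul_le_mul_of_nonneg_left e2 hc
    linarith
  have s5 := mul_nonneg hC hv
  have s6 := mul_nonneg hC hw
  have s7 : 0 ≤ 2 * z * c * C * D := by positivity
  rw [abs_le]
  constructor <;> linarith

lemma occ_eq_ratio (hΛ : ∀ e, 0 ≤ Λ e) (hr : 0 ≤ r) {H : Finset (Finset E)} {F : Finset E}
    {T : Finset (Finset E)} {e : E} (hA : Admissible H F T e) :
    occ Λ r F T e =
      Λ e * (partFun Λ r (insert e F) T / partFun Λ r (insert e F) (T.filter (e ∉ ·))) /
      (1 + Λ e * (partFun Λ r (insert e F) T /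
        partFun Λ r (insert e F) (T.filter (e ∉ ·)))) := by
  have h0 : 1 ≤ partFun Λ r (insert e F) (T.filter (e ∉ ·)) :=
    one_le_partFun hΛ hr fun t ht => hA.not_subset t (Finset.mem_filter.1 ht).1
  have h1 : 0 ≤ partFun Λ r (insert e F) T := partFun_nonneg hΛ hr _ _
  have h2 := mul_nonneg (hΛ e) h1
  unfold occ
  rw [partFun_split hA.notMem]
  field_simp

lemma abs_mul_sub_sq_le {p q x C D h : ℝ} (hp0 : 0 ≤ h * p) (hp : h * p ≤ C) (hx0 : 0 ≤ x)
    (hx : x ≤ C) (hpx : |h * p - x| ≤ D) (hqx : |h * q - x| ≤ D) :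
    |h ^ 2 * (p * q) - x ^ 2| ≤ 2 * C * D := by
  have : h ^ 2 * (p * q) - x ^ 2 = h * p * (h * q - x) + x * (h * p - x) := by ring
  rw [this]
  refine (abs_add_le _ _).trans ?_
  rw [abs_mul (h * p), abs_mul x, abs_of_nonneg hp0, abs_of_nonneg hx0]
  have := abs_nonneg (h * q - x)
  have := abs_nonneg (h * p - x)
  nlinarith

set_option maxHeartbeats 1000000 in
/-- One application of the recursion for occupation probabilities. -/
lemma occ_step (hΛ : ∀ e, 0 ≤ Λ e) (hr : 0 ≤ r) (hr1 : r ≤ 1) {H : Finset (Finset E)} {d : ℕ}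
    (hH : IsLinearTriple H d) {F : Finset E} {T : Finset (Finset E)} {e : E}
    (hA : Admissible H F T e) {h c C x D κ : ℝ} (hh : 0 < h) (hhd : h ^ 2 = d + 2)
    (hC : ∀ e, h * Λ e ≤ C) (hc : |h * Λ e - c| ≤ κ) (hc0 : 0 ≤ c) (hx0 : 0 ≤ x)
    (hxC : x ≤ C) (hx : x = c * Real.exp (-((1 - r) * x ^ 2))) (hD0 : 0 ≤ D) (hDC : D ≤ 2 * C)
    (hCh : C ≤ h) (hCd : 10 * C ^ 2 ≤ h ^ 2) {u : ℕ} (hu : F.card + 2 ^ F.card ≤ u)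
    (hJ : ∀ U f g, Admissible H (insert e F) U f → Admissible H (insert f (insert e F)) U g →
      |h * occ Λ r (insert e F) U f - x| ≤ D ∧
      |h * occ Λ r (insert f (insert e F)) U g - x| ≤ D) :
    |h * occ Λ r F T e - x| ≤ 2 * (1 - r) * c * C * D +
      (κ + C * (C ^ 2 * (u + 2) / h ^ 2) + C * (50 * C ^ 4 / h ^ 2 + u * C / h) + C ^ 2 / h) := by
  have hC0 : 0 ≤ C := hx0.trans hxC
  have hh2 : 0 < h ^ 2 := by positivity
  set y₁ := max (x ^ 2 - 2 * C * D) 0 with hy₁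
  set y₂ := x ^ 2 + 2 * C * D with hy₂
  have hxx : x ^ 2 ≤ C ^ 2 := pow_le_pow_left₀ hx0 hxC 2
  have hCD : 0 ≤ C * D := mul_nonneg hC0 hD0
  have hy₁0 : 0 ≤ y₁ := le_max_right _ _
  have hy₁C : y₁ ≤ C ^ 2 := max_le (by nlinarith) (by positivity)
  have hy₂0 : 0 ≤ y₂ := by positivity
  have hy₂C : y₂ ≤ 5 * C ^ 2 := by nlinarith
  have hl : ∀ e, Λ e ≤ C / h := fun e => by rw [le_div_iff₀ hh, mul_comm]; exact hC e
  have hl1 : C / h ≤ 1 := (div_le_one hh).2 hCh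
  have hl0 : 0 ≤ C / h := by positivity
  have ha1 : y₁ / h ^ 2 ≤ 1 := (div_le_one hh2).2 (by nlinarith)
  have hb2 : y₂ / h ^ 2 ≤ 1 / 2 := by rw [div_le_iff₀ hh2]; nlinarith
  have hbd := partFun_ratio_bounds hΛ hr hr1 hH hA hl hl1 (a := y₁ / h ^ 2) (b := y₂ / h ^ 2)
    (by positivity) (by linarith) (by positivity) ha1 (by
      intro U f g hf hg
      obtain ⟨h1, h2⟩ := hJ U f g hf hg
      have hp0 := occ_nonneg hΛ hr (insert e F) U f
      have hq0 := occ_nonneg hΛ hr (insert f (insert e F)) U g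
      have hp1 := occ_le hΛ hr hr1 (insert e F) U f
      have key := abs_le.1 (abs_mul_sub_sq_le (mul_nonneg hh.le hp0)
        ((mul_le_mul_of_nonneg_left hp1 hh.le).trans (hC f)) hx0 hxC h1 h2)
      have hpq := mul_nonneg hp0 hq0
      constructor
      · rw [div_le_iff₀ hh2]
        refine max_le (by linarith) (by positivity)
      · rw [le_div_iff₀ hh2]
        linarith) (T.filter (e ∈ ·)) (Finset.Subset.refl _)
  rw [Finset.union_comm, Finset.filter_union_filter_not_eq] at hbd
  obtain ⟨hlo, hhi⟩ := hbd
  set S := T.filter (e ∈ ·) with hS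
  have hP0 : 0 < partFun Λ r (insert e F) (T.filter (e ∉ ·)) := lt_of_lt_of_le one_pos
    (one_le_partFun hΛ hr fun t ht => hA.not_subset t (Finset.mem_filter.1 ht).1)
  rw [mul_comm, ← le_div_iff₀ hP0] at hlo
  rw [mul_comm, ← div_le_iff₀ hP0] at hhi
  rw [occ_eq_ratio hΛ hr hA]
  have hρ0 : 0 ≤ partFun Λ r (insert e F) T / partFun Λ r (insert e F) (T.filter (e ∉ ·)) :=
    div_nonneg (partFun_nonneg hΛ hr _ _) hP0.le
  generalize partFun Λ r (insert e F) T / partFun Λ r (insert e F) (T.filter (e ∉ ·)) = ρ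
    at hlo hhi hρ0 ⊢
  have hScard : S.card ≤ d := by
    rw [← hH.degree e]
    exact Finset.card_le_card (Finset.filter_subset_filter _ hA.subset)
  have huncl := (card_not_isClean_le hH hA.notMem).trans hu
  have hSu : (S.filter fun t => ¬ IsClean H F e t).card ≤ u := by
    refine le_trans (Finset.card_le_card ?_) huncl
    intro t ht
    rw [Finset.mem_filter, hS, Finset.mem_filter] at ht
    exact Finset.mem_filter.2 ⟨hA.subset ht.1.1, ht.1.2, ht.2⟩
  have hScl : (d : ℝ) - u ≤ ((S.filter (IsClean H F e)).card : ℝ) := by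
    have h1 : d ≤ (S.filter (IsClean H F e)).card +
        (H.filter fun t => e ∈ t ∧ ¬ IsClean H F e t).card := by
      rw [← hH.degree e]
      refine le_trans (Finset.card_le_card ?_) (Finset.card_union_le _ _)
      intro t ht
      rw [Finset.mem_filter] at ht
      rw [Finset.mem_union, Finset.mem_filter, Finset.mem_filter, Finset.mem_filter]
      by_cases hcl : IsClean H F e t
      · exact Or.inl ⟨⟨hA.mem_of_disjoint t ht.1 hcl.1, ht.2⟩, hcl⟩
      · exact Or.inr ⟨ht.1, ht.2, hcl⟩
    have h2 : (d : ℝ) ≤ (S.filter (IsClean H F e)).card + u := by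
      exact_mod_cast h1.trans (Nat.add_le_add_left huncl _)
    linarith
  have hz0 : 0 ≤ 1 - r := by linarith
  have hz1 : 1 - r ≤ 1 := by linarith
  have hhi' : ρ ≤ Real.exp (-((1 - r) * y₁)) + C ^ 2 * (u + 2) / h ^ 2 := by
    exact hhi.trans (one_sub_div_pow_le hz0 hz1 hy₁0 hy₁C hh2 ha1 (by linarith) (by positivity))
  have ht0 : 0 ≤ (1 - r) * (y₂ / h ^ 2) := by positivity
  have ht2 : (1 - r) * (y₂ / h ^ 2) ≤ 1 / 2 := by
    have : 0 ≤ y₂ / h ^ 2 := by positivity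
    nlinarith
  have hlo1 : Real.exp (-((1 - r) * y₂)) - 50 * C ^ 4 / h ^ 2 ≤
      (1 - (1 - r) * (y₂ / h ^ 2)) ^ S.card := by
    refine le_trans (le_of_eq ?_) (le_one_sub_div_pow hz0 hz1 hy₂0 hy₂C hh2 hb2 ?_)
    · ring
    · have : (S.card : ℝ) ≤ d := by exact_mod_cast hScard
      linarith
  have hlo2 : 1 - u * C / h ≤ (1 - C / h) ^ (S.filter fun t => ¬ IsClean H F e t).card := by
    refine le_trans ?_ (pow_le_pow_of_le_one (by linarith) (by linarith) hSu)
    have := one_add_mul_le_pow (a := -(C / h)) (by linarith) u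
    calc _ = 1 + (u : ℝ) * -(C / h) := by ring
      _ ≤ _ := this
      _ = _ := by ring
  have hlo' : Real.exp (-((1 - r) * y₂)) - (50 * C ^ 4 / h ^ 2 + u * C / h) ≤ ρ := by
    refine le_trans ?_ hlo
    set p := (1 - (1 - r) * (y₂ / h ^ 2)) ^ S.card
    set q := (1 - C / h) ^ (S.filter fun t => ¬ IsClean H F e t).card
    have hp0 : 0 ≤ p := pow_nonneg (by linarith) _
    have hp1 : p ≤ 1 := pow_le_one₀ (by linarith) (by linarith)
    have hu0 : 0 ≤ u * C / h := by positivity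
    nlinarith
  have hρ1 : ρ ≤ 1 := hhi.trans (pow_le_one₀
    (by have : 0 ≤ y₁ / h ^ 2 := by positivity
        nlinarith)
    (by have : 0 ≤ (1 - r) * (y₁ / h ^ 2) := by positivity
        linarith))
  have := occ_step_aux (D := D) hh (hΛ e) (hC e) hc hc0 hz0 hx hC0 hD0 hy₁0 hy₂0
    (by linarith [le_max_left (x ^ 2 - 2 * C * D) 0]) (by linarith) (by positivity) (by positivity)
    hhi' hlo' hρ0 hρ1
  linarith

end TriangleGas

section TriangleGas

variable {E : Type} [Fintype E] [DecidableEq E] {Λ : E → ℝ} {r : ℝ}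

lemma occ_close (hΛ : ∀ e, 0 ≤ Λ e) (hr : 0 ≤ r) (hr1 : r ≤ 1) {H : Finset (Finset E)} {d : ℕ}
    (hH : IsLinearTriple H d) {h c C x κ κ' z : ℝ} (hh : 0 < h) (hhd : h ^ 2 = d + 2)
    (hC : ∀ e, h * Λ e ≤ C) (hc : ∀ e, |h * Λ e - c| ≤ κ) (hc0 : 0 ≤ c) (hx0 : 0 ≤ x)
    (hxC : x ≤ C) (hx : x = c * Real.exp (-((1 - r) * x ^ 2)))
    (hCh : C ≤ h) (hCd : 10 * C ^ 2 ≤ h ^ 2) (hz : 1 - r ≤ z) (hz1 : 2 * z * c * C < 1) {L : ℕ}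
    (hκ0 : 0 ≤ κ') (hκ : κ + (C * (C ^ 2 * ((L + 2 ^ L : ℕ) + 2) / h ^ 2) +
      C * (50 * C ^ 4 / h ^ 2 + (L + 2 ^ L : ℕ) * C / h) + C ^ 2 / h) ≤ κ')
    (hκC : κ' / (1 - 2 * z * c * C) ≤ C) (k : ℕ) :
    ∀ F T e, Admissible H F T e → F.card + 2 * k ≤ L →
      |h * occ Λ r F T e - x| ≤ (2 * z * c * C) ^ k * C + κ' / (1 - 2 * z * c * C) := by
  have hC0 : 0 ≤ C := hx0.trans hxC
  have hz0 : 0 ≤ z := by linarith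
  have hρ0 : 0 ≤ 2 * z * c * C := by positivity
  have hκρ : 0 ≤ κ' / (1 - 2 * z * c * C) := div_nonneg hκ0 (by linarith)
  induction k with
  | zero =>
    intro F T e _ _
    have h1 : h * occ Λ r F T e ≤ C :=
      (mul_le_mul_of_nonneg_left (occ_le hΛ hr hr1 F T e) hh.le).trans (hC e)
    have h2 := mul_nonneg hh.le (occ_nonneg hΛ hr F T e)
    rw [pow_zero, one_mul, abs_le]
    constructor <;> linarith
  | succ k ih =>
    intro F T e hA hF
    have hD0 : 0 ≤ (2 * z * c * C) ^ k * C + κ' / (1 - 2 * z * c * C) := by positivity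
    have hDC : (2 * z * c * C) ^ k * C + κ' / (1 - 2 * z * c * C) ≤ 2 * C := by
      have := mul_le_of_le_one_left hC0 (pow_le_one₀ hρ0 hz1.le (n := k))
      linarith
    have hu : F.card + 2 ^ F.card ≤ L + 2 ^ L :=
      add_le_add (by omega) (Nat.pow_le_pow_right (by norm_num) (by omega))
    have step := occ_step hΛ hr hr1 hH hA hh hhd hC (hc e) hc0 hx0 hxC hx hD0 hDC hCh hCd hu
      (fun U f g hf hg => ⟨ih _ _ _ hf (by
        have := Finset.card_insert_le e F
        omega), ih _ _ _ hg (by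
        have := Finset.card_insert_le e F
        have := Finset.card_insert_le f (insert e F)
        omega)⟩)
    refine step.trans ?_
    set D := (2 * z * c * C) ^ k * C + κ' / (1 - 2 * z * c * C) with hD
    have h1 : 2 * (1 - r) * c * C * D ≤ 2 * z * c * C * D := by gcongr
    have h2 : 2 * z * c * C * D + κ' =
        (2 * z * c * C) ^ (k + 1) * C + κ' / (1 - 2 * z * c * C) := by
      have : 1 - 2 * z * c * C ≠ 0 := by linarith
      rw [hD, pow_succ]
      generalize 2 * z * c * C = ρ at *
      field_simp
      ring
    linarith

end TriangleGas

lemma tendsto_occ_error (C u : ℝ) : Tendsto (fun h : ℝ => C * (C ^ 2 * (u + 2) / h ^ 2) +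
    C * (50 * C ^ 4 / h ^ 2 + u * C / h) + C ^ 2 / h) atTop (nhds 0) := by
  have h2 : Tendsto (fun h : ℝ => h ^ 2) atTop atTop := tendsto_pow_atTop two_ne_zero
  have key := (((tendsto_const_nhds (x := C ^ 2 * (u + 2))).div_atTop h2).const_mul C).add
    ((((tendsto_const_nhds (x := 50 * C ^ 4)).div_atTop h2).add
      ((tendsto_const_nhds (x := u * C)).div_atTop tendsto_id)).const_mul C) |>.add
    ((tendsto_const_nhds (x := C ^ 2)).div_atTop tendsto_id)
  simpa using key

/-- Occupation probabilities are uniformly close to `x / h`, where `x` is the fixed point. -/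
lemma exists_occ_close {c z δ : ℝ} (hc : 0 < c) (hz0 : 0 ≤ z) (hz1 : z ≤ 1)
    (hzc : 2 * z * c ^ 2 < 1) (hδ : 0 < δ) (M : ℕ) :
    ∃ τ > 0, ∃ h₀ : ℝ, 0 < h₀ ∧ ∀ (E : Type) [Fintype E] [DecidableEq E] (Λ : E → ℝ) (r : ℝ)
      (H : Finset (Finset E)) (d : ℕ) (h x : ℝ), (∀ e, 0 ≤ Λ e) → 0 ≤ r → r ≤ 1 → 1 - r ≤ z →
      IsLinearTriple H d → h₀ ≤ h → h ^ 2 = d + 2 → (∀ e, |h * Λ e - c| ≤ τ) → 0 ≤ x →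
      x = c * Real.exp (-((1 - r) * x ^ 2)) → ∀ F T e, Admissible H F T e → F.card ≤ M →
      |h * occ Λ r F T e - x| ≤ δ := by
  set τ₀ := (1 - 2 * z * c ^ 2) / (4 * c) with hτ₀
  have hτ₀p : 0 < τ₀ := div_pos (by linarith) (by linarith)
  set C := c + τ₀ with hC
  have hCp : 0 < C := by positivity
  have hρ0 : 0 ≤ 2 * z * c * C := by positivity
  have hρ1 : 2 * z * c * C < 1 := by
    have : 2 * z * c * C = 2 * z * c ^ 2 + z * ((1 - 2 * z * c ^ 2) / 2) := by
      rw [hC, hτ₀]; field_simp; ring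
    rw [this]
    nlinarith
  obtain ⟨k, hk⟩ := exists_pow_lt_of_lt_one (show 0 < δ / 2 / C by positivity) hρ1
  rw [lt_div_iff₀ hCp] at hk
  set L := M + 2 * k
  set κ' := (1 - 2 * z * c * C) * min (δ / 2) C with hκ'
  have hκ'p : 0 < κ' := mul_pos (by linarith) (by positivity)
  have hκdiv : κ' / (1 - 2 * z * c * C) = min (δ / 2) C := by
    rw [hκ', mul_div_cancel_left₀]
    linarith
  have ev := ((tendsto_occ_error C ((L + 2 ^ L : ℕ) : ℝ)).eventually_lt_const
    (half_pos hκ'p)).and ((eventually_ge_atTop C).and ((tendsto_pow_atTop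
      (two_ne_zero (α := ℕ))).eventually_ge_atTop (10 * C ^ 2) |>.and (eventually_gt_atTop 0)))
  obtain ⟨h₀, hh₀⟩ := eventually_atTop.1 ev
  refine ⟨min τ₀ (κ' / 2), by positivity, h₀, (hh₀ h₀ le_rfl).2.2.2, ?_⟩
  intro E _ _ Λ r H d h x hΛ hr hr1 hrz hH hh hhd hΛc hx0 hx F T e hA hF
  obtain ⟨herr, hCh, hCd, hhp⟩ := hh₀ h hh
  have hxc : x ≤ c := by
    rw [hx]
    refine mul_le_of_le_one_right hc.le (Real.exp_le_one_iff.2 ?_)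
    nlinarith [mul_nonneg (sub_nonneg.2 hr1) (sq_nonneg x)]
  have := occ_close hΛ hr hr1 hH hhp hhd (C := C) (fun e => by
      have := (abs_le.1 (hΛc e)).2
      have := min_le_left τ₀ (κ' / 2)
      linarith) hΛc hc.le hx0 (by linarith) hx hCh hCd hrz hρ1 (L := L) hκ'p.le (by
      have := min_le_right τ₀ (κ' / 2)
      linarith) (by rw [hκdiv]; exact min_le_right _ _) k F T e hA (by omega)
  rw [hκdiv] at this
  have := min_le_left (δ / 2) C
  linarith

section Weight

variable {E : Type} [DecidableEq E] {Λ : E → ℝ} {r : ℝ}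

/-- The weight `∏_{e ∈ A} Λ e * r ^ #{t ∈ H | t ⊆ A}`. -/
def triWeight (Λ : E → ℝ) (r : ℝ) (H : Finset (Finset E)) (A : Finset E) : ℝ :=
  (∏ e ∈ A, Λ e) * r ^ (H.filter (· ⊆ A)).card

lemma triWeight_nonneg (hΛ : ∀ e, 0 ≤ Λ e) (hr : 0 ≤ r) (H : Finset (Finset E)) (A : Finset E) :
    0 ≤ triWeight Λ r H A :=
  mul_nonneg (Finset.prod_nonneg fun e _ => hΛ e) (pow_nonneg hr _)

lemma IsLinearTriple.not_subset {H : Finset (Finset E)} {d : ℕ} (hH : IsLinearTriple H d)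
    {F : Finset E} (hF : F.card ≤ 2) : ∀ t ∈ H, ¬ t ⊆ F := fun t ht h => by
  have := Finset.card_le_card h
  have := hH.card_eq t ht
  omega

lemma IsLinearTriple.admissible {H : Finset (Finset E)} {d : ℕ} (hH : IsLinearTriple H d)
    {F : Finset E} {e : E} (hF : F.card ≤ 1) (he : e ∉ F) : Admissible H F H e where
  subset := Finset.Subset.refl _
  mem_of_disjoint _ ht _ := ht
  notMem := he
  not_subset := hH.not_subset (by
    have := Finset.card_insert_le e F
    omega)

lemma IsLinearTriple.admissible_erase {H : Finset (Finset E)} {d : ℕ} (hH : IsLinearTriple H d)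
    {e f g : E} (heg : e ≠ g) (hfg : f ≠ g) :
    Admissible H {f, e} (H.erase {g, f, e}) g where
  subset := Finset.erase_subset _ _
  mem_of_disjoint t ht hd := by
    refine Finset.mem_erase.2 ⟨?_, ht⟩
    rintro rfl
    simp at hd
  notMem := by simp [hfg.symm, heg.symm]
  not_subset t ht h := by
    obtain ⟨hne, ht⟩ := Finset.mem_erase.1 ht
    refine hne (Finset.eq_of_subset_of_card_le h ?_)
    rw [hH.card_eq t ht]
    exact Finset.card_le_three

variable [Fintype E]

lemma sum_triWeight_superset (Λ : E → ℝ) (r : ℝ) (H : Finset (Finset E)) (D : Finset E) :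
    ∑ A with D ⊆ A, triWeight Λ r H A = (∏ e ∈ D, Λ e) * partFun Λ r D H := by
  have := sum_superset (Λ := Λ) (r := r) (F := ∅) (Finset.disjoint_empty_right D) H
  simpa [triWeight] using this

lemma sum_triWeight (Λ : E → ℝ) (r : ℝ) (H : Finset (Finset E)) :
    ∑ A, triWeight Λ r H A = partFun Λ r ∅ H := by
  simp [triWeight, partFun]

lemma edge_marginal (hΛ : ∀ e, 0 ≤ Λ e) (hr : 0 ≤ r) {H : Finset (Finset E)} {d : ℕ}
    (hH : IsLinearTriple H d) (e : E) :
    ∑ A with e ∈ A, triWeight Λ r H A = occ Λ r ∅ H e * ∑ A, triWeight Λ r H A := by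
  have h1 : (0:ℝ) < partFun Λ r ∅ H :=
    lt_of_lt_of_le one_pos (one_le_partFun hΛ hr (hH.not_subset (by simp)))
  have h2 := sum_triWeight_superset Λ r H {e}
  simp only [Finset.singleton_subset_iff, Finset.prod_singleton] at h2
  rw [h2, sum_triWeight, occ, div_mul_cancel₀ _ h1.ne']
  rfl

lemma triple_marginal (hΛ : ∀ e, 0 ≤ Λ e) (hr : 0 ≤ r) (hr1 : r ≤ 1) {H : Finset (Finset E)}
    {d : ℕ} (hH : IsLinearTriple H d) {e f g : E} (hef : e ≠ f) (heg : e ≠ g) (hfg : f ≠ g)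
    (ht : {g, f, e} ∈ H) (hg : Λ g < 1) :
    ∑ A with {g, f, e} ⊆ A, triWeight Λ r H A =
      r * (occ Λ r ∅ H e * occ Λ r {e} H f * occ Λ r {f, e} (H.erase {g, f, e}) g /
        (1 - (1 - r) * occ Λ r {f, e} (H.erase {g, f, e}) g)) * ∑ A, triWeight Λ r H A := by
  set t : Finset E := {g, f, e} with htdef
  have h0 : (0:ℝ) < partFun Λ r ∅ H :=
    lt_of_lt_of_le one_pos (one_le_partFun hΛ hr (hH.not_subset (by simp)))
  have h1 : (0:ℝ) < partFun Λ r {e} H :=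
    lt_of_lt_of_le one_pos (one_le_partFun hΛ hr (hH.not_subset (by simp)))
  have h2 : (0:ℝ) < partFun Λ r {f, e} (H.erase t) :=
    lt_of_lt_of_le one_pos (one_le_partFun hΛ hr fun s hs =>
      hH.not_subset Finset.card_le_two s (Finset.mem_erase.1 hs).2)
  have i1 : partFun Λ r t H = r * partFun Λ r t (H.erase t) := by
    have := partFun_insert (Λ := Λ) (r := r) t (Finset.notMem_erase t H)
    rw [Finset.insert_erase ht] at this
    rw [this]
    simp
    ring
  have i2 : partFun Λ r {f, e} H = partFun Λ r {f, e} (H.erase t) -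
      (1 - r) * (Λ g * partFun Λ r t (H.erase t)) := by
    have := partFun_insert (Λ := Λ) (r := r) {f, e} (Finset.notMem_erase t H)
    rw [Finset.insert_erase ht] at this
    have hu : ({f, e} : Finset E) ∪ t = t :=
      Finset.union_eq_right.2 (Finset.subset_insert _ _)
    have hs : t \ {f, e} = {g} := by
      ext a
      simp only [htdef, Finset.mem_sdiff, Finset.mem_insert, Finset.mem_singleton]
      constructor
      · tauto
      · rintro rfl
        simp [hfg.symm, heg.symm]
    rw [this, hu, hs, Finset.prod_singleton]
  have hq : occ Λ r {f, e} (H.erase t) g < 1 := (occ_le hΛ hr hr1 _ _ _).trans_lt hg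
  have hq0 := occ_nonneg hΛ hr {f, e} (H.erase t) g
  have hden : 0 < 1 - (1 - r) * occ Λ r {f, e} (H.erase t) g := by nlinarith
  have j0 : occ Λ r ∅ H e * partFun Λ r ∅ H = Λ e * partFun Λ r {e} H :=
    div_mul_cancel₀ _ h0.ne'
  have j1 : occ Λ r {e} H f * partFun Λ r {e} H = Λ f * partFun Λ r {f, e} H :=
    div_mul_cancel₀ _ h1.ne'
  have j2 : occ Λ r {f, e} (H.erase t) g * partFun Λ r {f, e} (H.erase t) =
      Λ g * partFun Λ r t (H.erase t) := div_mul_cancel₀ _ h2.ne'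
  have hprod : ∏ a ∈ t, Λ a = Λ g * (Λ f * Λ e) := by
    rw [htdef, Finset.prod_insert (by simp [hfg.symm, heg.symm]),
      Finset.prod_pair hef.symm]
  rw [sum_triWeight_superset, sum_triWeight, hprod, i1]
  generalize occ Λ r {f, e} (H.erase t) g = q at *
  have i3 : partFun Λ r {f, e} H = partFun Λ r {f, e} (H.erase t) * (1 - (1 - r) * q) := by
    rw [i2, ← j2]; ring
  clear i2 hq
  generalize 1 - (1 - r) * q = s at *
  calc _ = r * (Λ f * Λ e) * (Λ g * partFun Λ r t (H.erase t)) := by ring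
    _ = r * (Λ f * Λ e) * (q * partFun Λ r {f, e} (H.erase t)) := by rw [j2]
    _ = r * q / s * Λ e * (Λ f * partFun Λ r {f, e} H) := by
        rw [i3]; field_simp
    _ = r * q / s * occ Λ r {e} H f * (Λ e * partFun Λ r {e} H) := by
        rw [← j1]; ring
    _ = _ := by rw [← j0]; ring

end Weight

lemma triple_product_close {a₁ a₂ a₃ x K δ ζ h : ℝ} (h1 : 0 ≤ a₁) (h2 : 0 ≤ a₂) (h3 : 0 ≤ a₃)
    (hx : 0 ≤ x) (k1 : a₁ ≤ K) (k2 : a₂ ≤ K) (k3 : a₃ ≤ K) (kx : x ≤ K) (hζ0 : 0 ≤ ζ)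
    (hζ1 : ζ ≤ 1) (hh : 0 < h) (hK : 2 * K ≤ h) (d1 : |a₁ - x| ≤ δ) (d2 : |a₂ - x| ≤ δ)
    (d3 : |a₃ - x| ≤ δ) :
    |a₁ * a₂ * a₃ / (1 - ζ * (a₃ / h)) - x ^ 3| ≤ 3 * K ^ 2 * δ + 2 * K ^ 4 / h := by
  have hs0 : 0 ≤ ζ * (a₃ / h) := by positivity
  have hK0 : 0 ≤ K := hx.trans kx
  have hs1 : ζ * (a₃ / h) ≤ K / h :=
    calc ζ * (a₃ / h) ≤ 1 * (K / h) := by gcongr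
      _ = _ := one_mul _
  have hs2 : K / h ≤ 1 / 2 := by rw [div_le_iff₀ hh]; linarith
  set s := ζ * (a₃ / h)
  have hP : a₁ * a₂ * a₃ ≤ K ^ 3 :=
    calc a₁ * a₂ * a₃ ≤ K * K * K := by gcongr
      _ = _ := by ring
  have hP0 : 0 ≤ a₁ * a₂ * a₃ := by positivity
  have e1 : |a₁ * a₂ * a₃ - x ^ 3| ≤ 3 * K ^ 2 * δ := by
    have : a₁ * a₂ * a₃ - x ^ 3 = a₂ * a₃ * (a₁ - x) + x * a₃ * (a₂ - x) + x * x * (a₃ - x) := by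
      ring
    rw [this]
    refine (abs_add_three _ _ _).trans ?_
    rw [abs_mul, abs_mul _ (a₂ - x), abs_mul _ (a₃ - x), abs_of_nonneg (by positivity),
      abs_of_nonneg (by positivity : 0 ≤ x * a₃), abs_of_nonneg (by positivity : 0 ≤ x * x)]
    calc _ ≤ K * K * δ + K * K * δ + K * K * δ := by gcongr
      _ = _ := by ring
  have e2 : a₁ * a₂ * a₃ / (1 - s) - a₁ * a₂ * a₃ = a₁ * a₂ * a₃ * (s / (1 - s)) := by
    have : 1 - s ≠ 0 := by linarith
    field_simp
    ring
  have e3 : s / (1 - s) ≤ 2 * (K / h) := by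
    rw [div_le_iff₀ (by linarith)]
    nlinarith
  have e4 : 0 ≤ s / (1 - s) := div_nonneg hs0 (by linarith)
  have e5 : a₁ * a₂ * a₃ * (s / (1 - s)) ≤ 2 * K ^ 4 / h :=
    calc _ ≤ K ^ 3 * (2 * (K / h)) := by gcongr
      _ = _ := by ring
  have e6 := mul_nonneg hP0 e4
  rw [abs_le] at e1 ⊢
  constructor <;> linarith

/-- Marginals of single elements and of triples under the tilted measure. -/
lemma exists_marginals_close {c z δ : ℝ} (hc : 0 < c) (hz0 : 0 ≤ z) (hz1 : z ≤ 1)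
    (hzc : 2 * z * c ^ 2 < 1) (hδ : 0 < δ) :
    ∃ τ > 0, ∃ h₀ : ℝ, 0 < h₀ ∧ ∀ (E : Type) [Fintype E] [DecidableEq E] (Λ : E → ℝ) (r : ℝ)
      (H : Finset (Finset E)) (d : ℕ) (h x : ℝ), (∀ e, 0 ≤ Λ e) → 0 ≤ r → r ≤ 1 → 1 - r ≤ z →
      IsLinearTriple H d → h₀ ≤ h → h ^ 2 = d + 2 → (∀ e, |h * Λ e - c| ≤ τ) → 0 ≤ x →
      x = c * Real.exp (-((1 - r) * x ^ 2)) →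
      (0 < ∑ A, triWeight Λ r H A) ∧
      (∀ e, |h * ((∑ A with e ∈ A, triWeight Λ r H A) / ∑ A, triWeight Λ r H A) - x| ≤ δ) ∧
      (∀ t ∈ H, |h ^ 3 * ((∑ A with t ⊆ A, triWeight Λ r H A) / ∑ A, triWeight Λ r H A) -
        r * x ^ 3| ≤ δ) := by
  set K := c + 1
  have hK : 0 < K := by positivity
  set δ' := min (min 1 δ) (δ / (6 * K ^ 2))
  have hδ' : 0 < δ' := by positivity
  have hδ1 : δ' ≤ 1 := (min_le_left _ _).trans (min_le_left _ _)
  have hδ2 : δ' ≤ δ := (min_le_left _ _).trans (min_le_right _ _)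
  have hδ3 : 3 * K ^ 2 * δ' ≤ δ / 2 :=
    calc _ ≤ 3 * K ^ 2 * (δ / (6 * K ^ 2)) := by gcongr; exact min_le_right _ _
      _ = _ := by field_simp; norm_num
  obtain ⟨τ, hτ, h₀, hh₀, key⟩ := exists_occ_close hc hz0 hz1 hzc hδ' 2
  refine ⟨min τ 1, by positivity, max h₀ (max (2 * K) (4 * K ^ 4 / δ)), by positivity, ?_⟩
  intro E _ _ Λ r H d h x hΛ hr hr1 hrz hH hh hhd hΛc hx0 hx
  have hhh₀ : h₀ ≤ h := (le_max_left _ _).trans hh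
  have hhK : 2 * K ≤ h := (le_max_left _ _).trans ((le_max_right _ _).trans hh)
  have hhK4 : 4 * K ^ 4 / δ ≤ h := (le_max_right _ _).trans ((le_max_right _ _).trans hh)
  have hhp : 0 < h := hh₀.trans_le hhh₀
  have key := key E Λ r H d h x hΛ hr hr1 hrz hH hhh₀ hhd
    (fun e => (hΛc e).trans (min_le_left _ _)) hx0 hx
  have hxc : x ≤ c := by
    rw [hx]
    refine mul_le_of_le_one_right hc.le (Real.exp_le_one_iff.2 ?_)
    nlinarith [mul_nonneg (sub_nonneg.2 hr1) (sq_nonneg x)]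
  have hZ : 0 < ∑ A, triWeight Λ r H A := by
    rw [sum_triWeight]
    exact lt_of_lt_of_le one_pos (one_le_partFun hΛ hr (hH.not_subset (by simp)))
  refine ⟨hZ, fun e => ?_, fun t ht => ?_⟩
  · rw [edge_marginal hΛ hr hH, mul_div_cancel_right₀ _ hZ.ne']
    exact (key ∅ H e (hH.admissible (by simp) (by simp)) (by simp)).trans hδ2
  · obtain ⟨g, f, e, hgf, hge, hfe, rfl⟩ := Finset.card_eq_three.1 (hH.card_eq t ht)
    have hΛ1 : Λ g < 1 := by
      have := (abs_le.1 ((hΛc g).trans (min_le_right _ _))).2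
      by_contra hcon
      have : h ≤ h * Λ g := le_mul_of_one_le_right hhp.le (not_lt.1 hcon)
      linarith
    rw [triple_marginal hΛ hr hr1 hH hfe.symm hge.symm hgf.symm ht hΛ1, mul_div_cancel_right₀ _ hZ.ne']
    have d1 := key ∅ H e (hH.admissible (by simp) (by simp)) (by simp)
    have d2 := key {e} H f (hH.admissible (by simp) (by simpa using hfe)) (by simp)
    have d3 := key {f, e} _ g (hH.admissible_erase hge.symm hgf.symm) Finset.card_le_two
    have p1 := mul_nonneg hhp.le (occ_nonneg hΛ hr ∅ H e)
    have p2 := mul_nonneg hhp.le (occ_nonneg hΛ hr {e} H f)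
    have p3 := mul_nonneg hhp.le (occ_nonneg hΛ hr {f, e} (H.erase {g, f, e}) g)
    have q1 := (abs_le.1 d1).2
    have q2 := (abs_le.1 d2).2
    have q3 := (abs_le.1 d3).2
    have tp := triple_product_close p1 p2 p3 hx0 (K := K) (by linarith) (by linarith) (by linarith)
      (by linarith) (sub_nonneg.2 hr1) (by linarith) hhp hhK d1 d2 d3
    rw [mul_div_cancel_left₀ _ hhp.ne'] at tp
    have hb : 2 * K ^ 4 / h ≤ δ / 2 := by
      rw [div_le_iff₀ hδ] at hhK4
      rw [div_le_iff₀ hhp]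
      linarith
    generalize occ Λ r ∅ H e = o₁ at *
    generalize occ Λ r {e} H f = o₂ at *
    generalize occ Λ r {f, e} (H.erase {g, f, e}) g = o₃ at *
    have : h ^ 3 * (r * (o₁ * o₂ * o₃ / (1 - (1 - r) * o₃))) - r * x ^ 3 =
        r * (h * o₁ * (h * o₂) * (h * o₃) / (1 - (1 - r) * o₃) - x ^ 3) := by ring
    rw [this, abs_mul, abs_of_nonneg hr]
    exact (mul_le_of_le_one_left (abs_nonneg _) hr1).trans (by linarith)

/-- Jensen's inequality for `exp` with unnormalized weights. -/
lemma sum_mul_exp_ge {ι : Type*} (s : Finset ι) {w g : ι → ℝ} (hw : ∀ i ∈ s, 0 ≤ w i)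
    (hW : 0 < ∑ i ∈ s, w i) :
    (∑ i ∈ s, w i) * Real.exp ((∑ i ∈ s, w i * g i) / ∑ i ∈ s, w i) ≤
      ∑ i ∈ s, w i * Real.exp (g i) := by
  set m := (∑ i ∈ s, w i * g i) / ∑ i ∈ s, w i with hm
  have h1 : ∀ i ∈ s, w i * (Real.exp m * (g i - m + 1)) ≤ w i * Real.exp (g i) := by
    intro i hi
    refine mul_le_mul_of_nonneg_left ?_ (hw i hi)
    calc Real.exp m * (g i - m + 1) ≤ Real.exp m * Real.exp (g i - m) :=
          mul_le_mul_of_nonneg_left (Real.add_one_le_exp _) (Real.exp_pos _).le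
      _ = _ := by rw [← Real.exp_add]; ring_nf
  refine le_trans (le_of_eq ?_) (Finset.sum_le_sum h1)
  have h2 : ∑ i ∈ s, w i * (Real.exp m * (g i - m + 1)) =
      Real.exp m * (∑ i ∈ s, w i * g i - m * ∑ i ∈ s, w i + ∑ i ∈ s, w i) := by
    rw [Finset.mul_sum, ← Finset.sum_sub_distrib, ← Finset.sum_add_distrib, Finset.mul_sum]
    exact Finset.sum_congr rfl fun i _ => by ring
  rw [h2, hm, div_mul_cancel₀ _ hW.ne']
  ring

/-- Exponential tilting bound: the mass of `{0 ≤ f}` is controlled by the mean of `f` under the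
tilted weights `v`. -/
lemma sum_filter_nonneg_le {ι : Type*} [Fintype ι] {w v f : ι → ℝ} {θ K : ℝ}
    (hw : ∀ i, 0 ≤ w i) (hθ : 0 ≤ θ) (hK : 0 < K)
    (hv : ∀ i, K * v i = w i * Real.exp (θ * f i)) (hV : 0 < ∑ i, v i) :
    ∑ i with 0 ≤ f i, w i ≤ (∑ i, w i) * Real.exp (θ * ((∑ i, v i * f i) / ∑ i, v i)) := by
  have hv0 : ∀ i, 0 ≤ v i := fun i => by
    have : 0 ≤ K * v i := by rw [hv]; exact mul_nonneg (hw i) (Real.exp_pos _).le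
    exact nonneg_of_mul_nonneg_right this hK
  have h1 : ∑ i with 0 ≤ f i, w i ≤ K * ∑ i, v i := by
    rw [Finset.mul_sum, Finset.sum_filter]
    refine Finset.sum_le_sum fun i _ => ?_
    rw [hv]
    split_ifs with hf
    · exact le_mul_of_one_le_right (hw i) (Real.one_le_exp (mul_nonneg hθ hf))
    · exact mul_nonneg (hw i) (Real.exp_pos _).le
  have h2 := sum_mul_exp_ge Finset.univ (w := v) (g := fun i => -(θ * f i)) (fun i _ => hv0 i) hV
  have h3 : ∑ i, v i * Real.exp (-(θ * f i)) = (∑ i, w i) / K := by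
    rw [Finset.sum_div]
    refine Finset.sum_congr rfl fun i _ => ?_
    rw [eq_div_iff hK.ne', mul_right_comm, mul_comm (v i), hv, mul_assoc, ← Real.exp_add]
    simp
  have h4 : (∑ i, v i * -(θ * f i)) / ∑ i, v i = -(θ * ((∑ i, v i * f i) / ∑ i, v i)) := by
    rw [← mul_div_assoc, ← neg_div, Finset.mul_sum, ← Finset.sum_neg_distrib]
    congr 1
    exact Finset.sum_congr rfl fun i _ => by ring
  rw [h3, h4, le_div_iff₀ hK] at h2
  refine h1.trans ?_
  calc K * ∑ i, v i = (∑ i, v i) * Real.exp (-(θ * ((∑ i, v i * f i) / ∑ i, v i))) * K *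
        Real.exp (θ * ((∑ i, v i * f i) / ∑ i, v i)) := by
        rw [Real.exp_neg]; field_simp
    _ ≤ _ := mul_le_mul_of_nonneg_right h2 (Real.exp_pos _).le

section Weight

variable {E : Type} [DecidableEq E] {Λ : E → ℝ} {r : ℝ}

lemma triWeight_mul_exp (Λ : E → ℝ) (r : ℝ) (H : Finset (Finset E)) (y : E → ℝ) (θ : ℝ)
    (A : Finset E) :
    triWeight Λ r H A * Real.exp (θ * ∑ e ∈ A, y e) =
      triWeight (fun e => Λ e * Real.exp (θ * y e)) r H A := by
  unfold triWeight
  rw [Finset.prod_mul_distrib, Finset.mul_sum, Real.exp_sum]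
  ring

variable [Fintype E]

lemma sum_triWeight_mul_sum (Λ : E → ℝ) (r : ℝ) (H : Finset (Finset E)) (y : E → ℝ) :
    ∑ A, triWeight Λ r H A * ∑ e ∈ A, y e = ∑ e, y e * ∑ A with e ∈ A, triWeight Λ r H A := by
  have h1 : ∀ A : Finset E, ∑ e ∈ A, y e = ∑ e, if e ∈ A then y e else 0 := fun A => by simp
  simp_rw [h1, Finset.mul_sum, Finset.sum_filter]
  rw [Finset.sum_comm]
  refine Finset.sum_congr rfl fun e _ => Finset.sum_congr rfl fun A _ => ?_
  split_ifs <;> ring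

lemma sum_triWeight_mul_card (Λ : E → ℝ) (r : ℝ) (H : Finset (Finset E)) :
    ∑ A, triWeight Λ r H A * ((H.filter (· ⊆ A)).card : ℝ) =
      ∑ t ∈ H, ∑ A with t ⊆ A, triWeight Λ r H A := by
  simp_rw [Finset.card_filter, Nat.cast_sum, Finset.mul_sum, Finset.sum_filter]
  rw [Finset.sum_comm]
  refine Finset.sum_congr rfl fun e _ => Finset.sum_congr rfl fun A _ => ?_
  split_ifs <;> simp

/-- Mean of the number of members of `H` contained in the random set. -/
def triMean (Λ : E → ℝ) (r : ℝ) (H : Finset (Finset E)) : ℝ :=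
  (∑ A, triWeight Λ r H A * ((H.filter (· ⊆ A)).card : ℝ)) / ∑ A, triWeight Λ r H A

lemma triMean_close (H : Finset (Finset E)) {h δ q : ℝ} (hh : 0 < h)
    (hZ : ∀ t ∈ H, |h ^ 3 * ((∑ A with t ⊆ A, triWeight Λ r H A) / ∑ A, triWeight Λ r H A) - q| ≤ δ) :
    |triMean Λ r H - H.card / h ^ 3 * q| ≤ H.card / h ^ 3 * δ := by
  have h3 : 0 < h ^ 3 := by positivity
  have h1 : triMean Λ r H - H.card / h ^ 3 * q = (∑ t ∈ H, (h ^ 3 * ((∑ A with t ⊆ A,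
      triWeight Λ r H A) / ∑ A, triWeight Λ r H A) - q)) / h ^ 3 := by
    rw [triMean, sum_triWeight_mul_card, Finset.sum_sub_distrib, ← Finset.mul_sum,
      ← Finset.sum_div, Finset.sum_const, nsmul_eq_mul]
    field_simp
  rw [h1, abs_div, abs_of_pos h3, div_mul_eq_mul_div]
  refine div_le_div_of_nonneg_right ?_ h3.le
  refine (Finset.abs_sum_le_sum_abs _ _).trans ((Finset.sum_le_sum hZ).trans ?_)
  simp

lemma sum_card_ge_le (hΛ : ∀ e, 0 ≤ Λ e) {r r' : ℝ} (hr : 0 < r) (hr' : r ≤ r')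
    (H : Finset (Finset E)) (hZ : 0 < ∑ A, triWeight Λ r' H A) (s : ℝ) :
    ∑ A with s ≤ ((H.filter (· ⊆ A)).card : ℝ), triWeight Λ r H A ≤
      (∑ A, triWeight Λ r H A) * Real.exp (Real.log (r' / r) * (triMean Λ r' H - s)) := by
  have hr'0 : 0 < r' := hr.trans_le hr'
  have := sum_filter_nonneg_le (w := triWeight Λ r H) (v := triWeight Λ r' H)
    (f := fun A => ((H.filter (· ⊆ A)).card : ℝ) - s) (θ := Real.log (r' / r))
    (K := Real.exp (-(Real.log (r' / r) * s))) (triWeight_nonneg hΛ hr.le H)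
    (Real.log_nonneg ((one_le_div hr).2 hr')) (Real.exp_pos _) (fun A => by
      rw [mul_sub, sub_eq_add_neg, Real.exp_add, mul_comm (Real.log _) (Nat.cast _),
        Real.exp_nat_mul,
        Real.exp_log (by positivity)]
      unfold triWeight
      rw [div_pow]
      field_simp) hZ
  simp only [sub_nonneg, mul_sub, Finset.sum_sub_distrib] at this
  refine this.trans (le_of_eq ?_)
  rw [← Finset.sum_mul, sub_div, mul_div_cancel_left₀ _ hZ.ne', triMean]

lemma sum_card_le_le (hΛ : ∀ e, 0 ≤ Λ e) {r r' : ℝ} (hr' : 0 < r') (hr : r' ≤ r)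
    (H : Finset (Finset E)) (hZ : 0 < ∑ A, triWeight Λ r' H A) (s : ℝ) :
    ∑ A with ((H.filter (· ⊆ A)).card : ℝ) ≤ s, triWeight Λ r H A ≤
      (∑ A, triWeight Λ r H A) * Real.exp (Real.log (r / r') * (s - triMean Λ r' H)) := by
  have hr0 : 0 < r := hr'.trans_le hr
  have := sum_filter_nonneg_le (w := triWeight Λ r H) (v := triWeight Λ r' H)
    (f := fun A => s - ((H.filter (· ⊆ A)).card : ℝ)) (θ := Real.log (r / r'))
    (K := Real.exp (Real.log (r / r') * s)) (triWeight_nonneg hΛ hr0.le H)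
    (Real.log_nonneg ((one_le_div hr').2 hr)) (Real.exp_pos _) (fun A => by
      rw [mul_sub, sub_eq_add_neg, Real.exp_add, Real.exp_neg, mul_comm (Real.log _) (Nat.cast _),
        Real.exp_nat_mul, Real.exp_log (by positivity)]
      unfold triWeight
      rw [div_pow]
      field_simp) hZ
  simp only [sub_nonneg, mul_sub, Finset.sum_sub_distrib] at this
  refine this.trans (le_of_eq ?_)
  rw [← Finset.sum_mul, sub_div, mul_div_cancel_left₀ _ hZ.ne', triMean]

end Weight

lemma fixedPoint_le {c ζ x : ℝ} (hc : 0 ≤ c) (hζ : 0 ≤ ζ)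
    (hx : x = c * Real.exp (-(ζ * x ^ 2))) : x ≤ c := by
  rw [hx]
  exact mul_le_of_le_one_right hc (Real.exp_le_one_iff.2 (neg_nonpos.2 (by positivity)))

lemma le_fixedPoint {c ζ x : ℝ} (hc : 0 ≤ c) (hζ : 0 ≤ ζ) (hζ1 : ζ ≤ 1) (hx0 : 0 ≤ x)
    (hx : x = c * Real.exp (-(ζ * x ^ 2))) : c * Real.exp (-c ^ 2) ≤ x := by
  have hxc := fixedPoint_le hc hζ hx
  rw [hx]
  refine mul_le_mul_of_nonneg_left (Real.exp_le_exp.2 (neg_le_neg ?_)) hc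
  have := pow_le_pow_left₀ hx0 hxc 2
  nlinarith [mul_nonneg (sub_nonneg.2 hζ1) (sq_nonneg x)]

/-- Linear statistics with negative total weight are negative with overwhelming probability. -/
lemma exists_linear_bound {c z κ₀ : ℝ} (hc : 0 < c) (hz0 : 0 ≤ z) (hz1 : z ≤ 1)
    (hzc : 2 * z * c ^ 2 < 1) (hκ₀ : 0 < κ₀) :
    ∃ κ > 0, ∃ τ > 0, ∃ h₀ : ℝ, 0 < h₀ ∧ ∀ (E : Type) [Fintype E] [DecidableEq E] (lam r : ℝ)
      (H : Finset (Finset E)) (d : ℕ) (h x : ℝ) (y : E → ℝ), 0 ≤ lam → 0 ≤ r → r ≤ 1 →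
      1 - r ≤ z → IsLinearTriple H d → h₀ ≤ h → h ^ 2 = d + 2 → |h * lam - c| ≤ τ → 0 ≤ x →
      x = c * Real.exp (-((1 - r) * x ^ 2)) → (∀ e, |y e| ≤ 1) → ∑ e, y e ≤ -(κ₀ * h ^ 4) →
      (Fintype.card E : ℝ) ≤ h ^ 4 →
      ∑ A with 0 ≤ ∑ e ∈ A, y e, triWeight (fun _ => lam) r H A ≤
        (∑ A, triWeight (fun _ => lam) r H A) * Real.exp (-(κ * h ^ 3)) := by
  set x₀ := c * Real.exp (-c ^ 2)
  have hx₀ : 0 < x₀ := by positivity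
  obtain ⟨τ₁, hτ₁, h₀, hh₀, key⟩ :=
    exists_marginals_close hc hz0 hz1 hzc (show 0 < x₀ * κ₀ / 2 by positivity)
  set θ := min 1 (τ₁ / (4 * c)) with hθ
  have hθ0 : 0 < θ := by positivity
  have hθ1 : θ ≤ 1 := min_le_left _ _
  have hθτ : c * (2 * θ) ≤ τ₁ / 2 :=
    calc _ ≤ c * (2 * (τ₁ / (4 * c))) := by gcongr; exact min_le_right _ _
      _ = _ := by field_simp; norm_num
  refine ⟨θ * (x₀ * κ₀ / 2), by positivity, τ₁ / 6, by positivity, h₀, hh₀, ?_⟩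
  intro E _ _ lam r H d h x y hlam hr hr1 hrz hH hh hhd hlc hx0 hx hy hysum hE
  have hhp : 0 < h := hh₀.trans_le hh
  set Λ : E → ℝ := fun e => lam * Real.exp (θ * y e) with hΛ
  have hΛ0 : ∀ e, 0 ≤ Λ e := fun e => mul_nonneg hlam (Real.exp_pos _).le
  have hΛc : ∀ e, |h * Λ e - c| ≤ τ₁ := by
    intro e
    have hu : |θ * y e| ≤ θ := by
      rw [abs_mul, abs_of_pos hθ0]
      exact mul_le_of_le_one_right hθ0.le (hy e)
    have h1 := Real.abs_exp_sub_one_le (hu.trans hθ1)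
    have h2 : |Real.exp (θ * y e)| ≤ 3 := by
      rw [abs_of_pos (Real.exp_pos _)]
      have := (abs_le.1 h1).2
      linarith
    have h3 : h * Λ e - c =
        (h * lam - c) * Real.exp (θ * y e) + c * (Real.exp (θ * y e) - 1) := by
      rw [hΛ]; ring
    rw [h3]
    refine (abs_add_le _ _).trans ?_
    rw [abs_mul, abs_mul, abs_of_pos hc]
    have h4 : |h * lam - c| * |Real.exp (θ * y e)| ≤ τ₁ / 6 * 3 := by gcongr
    have h5 : c * |Real.exp (θ * y e) - 1| ≤ c * (2 * θ) := by
      gcongr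
      linarith
    linarith
  obtain ⟨hZ, hm, -⟩ := key E Λ r H d h x hΛ0 hr hr1 hrz hH hh hhd hΛc hx0 hx
  refine (sum_filter_nonneg_le (w := triWeight (fun _ => lam) r H) (v := triWeight Λ r H)
    (θ := θ) (K := 1) (triWeight_nonneg (fun _ => hlam) hr H) hθ0.le one_pos
    (fun A => by rw [triWeight_mul_exp, one_mul]) hZ).trans ?_
  refine mul_le_mul_of_nonneg_left (Real.exp_le_exp.2 ?_)
    (Finset.sum_nonneg fun A _ => triWeight_nonneg (fun _ => hlam) hr H A)
  have hxx : x₀ ≤ x := le_fixedPoint hc.le (sub_nonneg.2 hr1) (by linarith) hx0 hx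
  rw [mul_assoc, ← mul_neg]
  refine mul_le_mul_of_nonneg_left ?_ hθ0.le
  rw [sum_triWeight_mul_sum, Finset.sum_div]
  set Z := ∑ A, triWeight Λ r H A
  have h1 : ∀ e, y e * (h * ((∑ A with e ∈ A, triWeight Λ r H A) / Z)) ≤
      y e * x + x₀ * κ₀ / 2 := by
    intro e
    have h2 : y e * (h * ((∑ A with e ∈ A, triWeight Λ r H A) / Z) - x) ≤ x₀ * κ₀ / 2 := by
      refine (le_abs_self _).trans ?_
      rw [abs_mul]
      exact (mul_le_of_le_one_left (abs_nonneg _) (hy e)).trans (hm e)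
    linarith
  have h2 : ∑ e, y e * (h * ((∑ A with e ∈ A, triWeight Λ r H A) / Z)) ≤
      -(x₀ * κ₀ / 2 * h ^ 4) := by
    refine (Finset.sum_le_sum fun e _ => h1 e).trans ?_
    rw [Finset.sum_add_distrib, ← Finset.sum_mul, Finset.sum_const, nsmul_eq_mul, Finset.card_univ]
    have h3 : (Fintype.card E : ℝ) * (x₀ * κ₀ / 2) ≤ h ^ 4 * (x₀ * κ₀ / 2) := by gcongr
    have h4 : (∑ e, y e) * x ≤ -(κ₀ * h ^ 4) * x := mul_le_mul_of_nonneg_right hysum hx0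
    have h5 : κ₀ * h ^ 4 * x₀ ≤ κ₀ * h ^ 4 * x := by gcongr
    linarith
  have h3 : ∑ e, y e * (h * ((∑ A with e ∈ A, triWeight Λ r H A) / Z)) =
      h * ∑ e, y e * (∑ A with e ∈ A, triWeight Λ r H A) / Z := by
    rw [Finset.mul_sum]
    exact Finset.sum_congr rfl fun e _ => by ring
  rw [h3] at h2
  refine le_of_mul_le_mul_left (h2.trans (le_of_eq ?_)) hhp
  ring

/-- The value of `ζ` for which `x` is the fixed point `x = c * exp (-ζ x ^ 2)`. -/
def zetaOf (c x : ℝ) : ℝ := Real.log (c / x) / x ^ 2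

/-- The limiting triangle density, relative to `c ^ 3`, at the fixed point `x`. -/
def triDensity (c x : ℝ) : ℝ := (1 - zetaOf c x) * (x / c) ^ 3

lemma fixedPoint_zetaOf {c x : ℝ} (hc : 0 < c) (hx : 0 < x) :
    x = c * Real.exp (-(zetaOf c x * x ^ 2)) := by
  rw [zetaOf, div_mul_cancel₀ _ (by positivity), Real.exp_neg, Real.exp_log (by positivity)]
  field_simp

lemma zetaOf_nonneg {c x : ℝ} (hx : 0 < x) (hxc : x ≤ c) : 0 ≤ zetaOf c x :=
  div_nonneg (Real.log_nonneg ((one_le_div hx).2 hxc)) (sq_nonneg x)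

lemma zetaOf_lt {c x x' : ℝ} (hx : 0 < x) (hxx : x < x') (hxc : x' ≤ c) :
    zetaOf c x' < zetaOf c x := by
  have hx' := hx.trans hxx
  have hc := hx'.trans_le hxc
  calc zetaOf c x' ≤ Real.log (c / x') / x ^ 2 :=
        div_le_div_of_nonneg_left (Real.log_nonneg ((one_le_div hx').2 hxc)) (by positivity)
          (pow_le_pow_left₀ hx.le hxx.le 2)
    _ < zetaOf c x := by
        refine div_lt_div_of_pos_right (Real.log_lt_log (by positivity) ?_) (by positivity)
        exact div_lt_div_of_pos_left hc hx hxx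

lemma continuousOn_triDensity {c x₁ : ℝ} (hc : 0 < c) (hx₁ : 0 < x₁) :
    ContinuousOn (triDensity c) (Set.Icc x₁ c) := by
  have hpos : ∀ x ∈ Set.Icc x₁ c, x ≠ 0 := fun x hx => (hx₁.trans_le hx.1).ne'
  unfold triDensity zetaOf
  refine ContinuousOn.mul (continuousOn_const.sub (ContinuousOn.div (ContinuousOn.log
    (continuousOn_const.div continuousOn_id hpos) fun x hx => ?_) (by fun_prop) fun x hx => ?_))
    (by fun_prop)
  · exact div_ne_zero hc.ne' (hpos x hx)
  · exact pow_ne_zero _ (hpos x hx)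

lemma triDensity_self {c : ℝ} (hc : 0 < c) : triDensity c c = 1 := by
  simp [triDensity, zetaOf, hc.ne']

lemma exists_triDensity_eq {c x₁ v : ℝ} (hc : 0 < c) (hx₁ : 0 < x₁) (hx₁c : x₁ ≤ c)
    (hv : triDensity c x₁ < v) (hv1 : v ≤ 1) : ∃ x, x₁ < x ∧ x ≤ c ∧ triDensity c x = v := by
  obtain ⟨x, hx, hxv⟩ := intermediate_value_Icc hx₁c (continuousOn_triDensity hc hx₁)
    (show v ∈ Set.Icc (triDensity c x₁) (triDensity c c) from
      ⟨hv.le, by rwa [triDensity_self hc]⟩)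
  refine ⟨x, lt_of_le_of_ne hx.1 ?_, hx.2, hxv⟩
  rintro rfl
  exact hv.ne hxv

/-- In a window below the typical triangle count, the tilted measure has most of its mass. -/
lemma exists_window_mass {c x₁ η ω : ℝ} (hc : 0 < c) (hx₁ : 0 < x₁) (hx₁c : x₁ ≤ c)
    (hζ1 : zetaOf c x₁ ≤ 1) (hζc : 2 * zetaOf c x₁ * c ^ 2 < 1) (hη1 : η < 1)
    (hω : 0 < ω) (hωx : triDensity c x₁ < η - ω) :
    ∃ x, x₁ ≤ x ∧ x ≤ c ∧ triDensity c x = η - ω / 2 ∧ 0 < 1 - zetaOf c x ∧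
      ∃ τ > 0, ∃ h₀ : ℝ, 0 < h₀ ∧ ∀ (E : Type) [Fintype E] [DecidableEq E] (lam : ℝ)
      (H : Finset (Finset E)) (d : ℕ) (h T : ℝ), 0 ≤ lam →
      IsLinearTriple H d → h₀ ≤ h → h ^ 2 = d + 2 → |h * lam - c| ≤ τ →
      h ^ 6 / 12 ≤ H.card →
      |T - η * c ^ 3 * (H.card / h ^ 3)| ≤ τ * (H.card / h ^ 3) →
      (∑ A, triWeight (fun _ => lam) (1 - zetaOf c x) H A) / 2 ≤
        ∑ A with T - ω * c ^ 3 * (H.card / h ^ 3) ≤ ((H.filter (· ⊆ A)).card : ℝ) ∧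
          ((H.filter (· ⊆ A)).card : ℝ) ≤ T, triWeight (fun _ => lam) (1 - zetaOf c x) H A := by
  obtain ⟨x₂, h12, h2c, hd2⟩ := exists_triDensity_eq hc hx₁ hx₁c
    (show triDensity c x₁ < η - 3 * ω / 4 by linarith) (by linarith)
  have hx₂ := hx₁.trans h12
  obtain ⟨x, h2x, hxc, hdx⟩ := exists_triDensity_eq hc hx₂ h2c
    (show triDensity c x₂ < η - ω / 2 by linarith) (by linarith)
  have hx := hx₂.trans h2x
  obtain ⟨x₃, hx3, h3c, hd3⟩ := exists_triDensity_eq hc hx hxc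
    (show triDensity c x < η - ω / 4 by linarith) (by linarith)
  have hx₃ := hx.trans hx3
  have hz2 : zetaOf c x₂ < zetaOf c x₁ := zetaOf_lt hx₁ h12 h2c
  have hzx : zetaOf c x < zetaOf c x₂ := zetaOf_lt hx₂ h2x hxc
  have hz3 : zetaOf c x₃ < zetaOf c x := zetaOf_lt hx hx3 h3c
  have hz30 : 0 ≤ zetaOf c x₃ := zetaOf_nonneg hx₃ h3c
  set δ := c ^ 3 * ω / 16 with hδ
  have hδ0 : 0 < δ := by positivity
  obtain ⟨τ, hτ, h₀, hh₀, key⟩ := exists_marginals_close hc (z := zetaOf c x₁)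
    (by linarith) hζ1 hζc hδ0
  set r₂ := 1 - zetaOf c x₂ with hr₂
  set r := 1 - zetaOf c x with hr
  set r₃ := 1 - zetaOf c x₃ with hr₃
  have hr20 : 0 < r₂ := by linarith
  have hr2r : r₂ < r := by linarith
  have hrr3 : r < r₃ := by linarith
  have hr0 : 0 < r := by linarith
  have hr30 : 0 < r₃ := by linarith
  have hl2 : 0 < Real.log (r / r₂) := Real.log_pos ((one_lt_div hr20).2 hr2r)
  have hl3 : 0 < Real.log (r₃ / r) := Real.log_pos ((one_lt_div hr0).2 hrr3)
  have hρ2 : r₂ * x₂ ^ 3 = c ^ 3 * (η - 3 * ω / 4) := by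
    rw [← hd2, triDensity, ← hr₂]; field_simp
  have hρ3 : r₃ * x₃ ^ 3 = c ^ 3 * (η - ω / 4) := by
    rw [← hd3, triDensity, ← hr₃]; field_simp
  set lm := min (Real.log (r / r₂)) (Real.log (r₃ / r))
  have hlm : 0 < lm := lt_min hl2 hl3
  obtain ⟨h₁, hh₁⟩ := eventually_atTop.1
    ((tendsto_pow_atTop (three_ne_zero (α := ℕ))).eventually_ge_atTop
      (Real.log 4 * 12 / (lm * (2 * δ))) : ∀ᶠ h : ℝ in atTop, _)
  refine ⟨x, (h12.trans h2x).le, hxc, hdx, hr0, min τ δ, by positivity, max h₀ h₁,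
    lt_max_of_lt_left hh₀, ?_⟩
  intro E _ _ lam H d h T hlam hH hh hhd hlc hHl hT
  have hhh₀ : h₀ ≤ h := (le_max_left _ _).trans hh
  have hhp : 0 < h := hh₀.trans_le hhh₀
  have hlog := hh₁ h ((le_max_right _ _).trans hh)
  have key := fun (r : ℝ) (x : ℝ) => key E (fun _ => lam) r H d h x (fun _ => hlam)
  obtain ⟨Z2, -, m2⟩ := key r₂ x₂ hr20.le (by linarith) (by linarith) hH hhh₀ hhd
    (fun _ => hlc.trans (min_le_left _ _)) hx₂.le
    (by rw [hr₂, sub_sub_cancel]; exact fixedPoint_zetaOf hc hx₂)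
  obtain ⟨Z3, -, m3⟩ := key r₃ x₃ hr30.le (by linarith) (by linarith) hH hhh₀ hhd
    (fun _ => hlc.trans (min_le_left _ _)) hx₃.le
    (by rw [hr₃, sub_sub_cancel]; exact fixedPoint_zetaOf hc hx₃)
  have M2 := abs_le.1 (triMean_close H hhp m2)
  have M3 := abs_le.1 (triMean_close H hhp m3)
  rw [hρ2] at M2
  rw [hρ3] at M3
  set Λ : E → ℝ := fun _ => lam
  set Q := (H.card : ℝ) / h ^ 3 with hQ
  have hQ0 : 0 ≤ Q := by positivity
  have hQh : h ^ 3 / 12 ≤ Q := by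
    rw [hQ, le_div_iff₀ (by positivity)]
    calc h ^ 3 / 12 * h ^ 3 = h ^ 6 / 12 := by ring
      _ ≤ _ := hHl
  have hT' := abs_le.1 (hT.trans (mul_le_mul_of_nonneg_right (min_le_right _ _) hQ0))
  have hQδ : Real.log 4 ≤ lm * (2 * δ * Q) := by
    have h1 : 0 < lm * (2 * δ) := by positivity
    rw [div_le_iff₀ h1] at hlog
    calc Real.log 4 ≤ h ^ 3 / 12 * (lm * (2 * δ)) := by linarith
      _ ≤ Q * (lm * (2 * δ)) := by gcongr
      _ = _ := by ring
  have hexp : ∀ l s, lm ≤ l → s ≤ -(2 * δ * Q) → Real.exp (l * s) ≤ 1 / 4 := by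
    intro l s hl hs
    have h4 : (1:ℝ) / 4 = Real.exp (-Real.log 4) := by
      rw [Real.exp_neg, Real.exp_log (by norm_num), one_div]
    rw [h4, Real.exp_le_exp]
    have h5 : 0 ≤ 2 * δ * Q := by positivity
    have h6 : l * s ≤ l * -(2 * δ * Q) := mul_le_mul_of_nonneg_left hs (hlm.le.trans hl)
    have h7 : lm * (2 * δ * Q) ≤ l * (2 * δ * Q) := mul_le_mul_of_nonneg_right hl h5
    linarith
  set Z := ∑ A, triWeight Λ r H A with hZ
  have hZ0 : 0 ≤ Z := Finset.sum_nonneg fun A _ => triWeight_nonneg (fun _ => hlam) hr0.le H A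
  have e16 : c ^ 3 * ω * Q = 16 * δ * Q := by rw [hδ]; ring
  have up : ∑ A with T ≤ ((H.filter (· ⊆ A)).card : ℝ), triWeight Λ r H A ≤ Z * (1 / 4) := by
    refine (sum_card_ge_le (fun _ => hlam) hr0 hrr3.le H Z3 T).trans ?_
    refine mul_le_mul_of_nonneg_left (hexp _ _ (min_le_right _ _) ?_) hZ0
    linarith
  have lo : ∑ A with ((H.filter (· ⊆ A)).card : ℝ) ≤ T - ω * c ^ 3 * Q, triWeight Λ r H A ≤
      Z * (1 / 4) := by
    refine (sum_card_le_le (fun _ => hlam) hr20 hr2r.le H Z2 _).trans ?_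
    refine mul_le_mul_of_nonneg_left (hexp _ _ (min_le_left _ _) ?_) hZ0
    linarith
  have hle : Z ≤ ∑ A with T ≤ ((H.filter (· ⊆ A)).card : ℝ), triWeight Λ r H A +
      ∑ A with ((H.filter (· ⊆ A)).card : ℝ) ≤ T - ω * c ^ 3 * Q, triWeight Λ r H A +
      ∑ A with T - ω * c ^ 3 * Q ≤ ((H.filter (· ⊆ A)).card : ℝ) ∧
          ((H.filter (· ⊆ A)).card : ℝ) ≤ T, triWeight Λ r H A := by
    rw [hZ, Finset.sum_filter, Finset.sum_filter, Finset.sum_filter, ← Finset.sum_add_distrib,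
      ← Finset.sum_add_distrib]
    refine Finset.sum_le_sum fun A _ => ?_
    have hA := triWeight_nonneg (Λ := Λ) (fun _ => hlam) hr0.le H A
    rcases le_total T ((H.filter (· ⊆ A)).card : ℝ) with h1 | h1 <;>
      rcases le_total (T - ω * c ^ 3 * Q) ((H.filter (· ⊆ A)).card : ℝ) with h2 | h2 <;>
      simp only [h1, h2, if_true, and_self, true_and] <;> split_ifs <;> linarith
  linarith

/-- Conditionally on having few triples, linear statistics with negative total weight are negative
with overwhelming probability. -/
lemma exists_conditional_bound {c x₁ η κ₀ : ℝ} (hc : 0 < c) (hx₁ : 0 < x₁) (hx₁c : x₁ ≤ c)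
    (hζ1 : zetaOf c x₁ ≤ 1) (hζc : 2 * zetaOf c x₁ * c ^ 2 < 1) (hη : 0 ≤ η) (hη1 : η < 1)
    (hx₁η : triDensity c x₁ < η ∨ (η = 0 ∧ zetaOf c x₁ = 1)) (hκ₀ : 0 < κ₀) :
    ∃ κ > 0, ∃ τ > 0, ∃ h₀ : ℝ, 0 < h₀ ∧ ∀ (E : Type) [Fintype E] [DecidableEq E] (lam : ℝ)
      (H : Finset (Finset E)) (d : ℕ) (h T : ℝ) (y : E → ℝ), 0 ≤ lam →
      IsLinearTriple H d → h₀ ≤ h → h ^ 2 = d + 2 → |h * lam - c| ≤ τ →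
      h ^ 6 / 12 ≤ H.card → H.card ≤ h ^ 6 → (η = 0 → T = 0) →
      |T - η * c ^ 3 * (H.card / h ^ 3)| ≤ τ * (H.card / h ^ 3) →
      (∀ e, |y e| ≤ 1) → ∑ e, y e ≤ -(κ₀ * h ^ 4) → (Fintype.card E : ℝ) ≤ h ^ 4 →
      ∑ A with 0 ≤ ∑ e ∈ A, y e ∧ ((H.filter (· ⊆ A)).card : ℝ) ≤ T, lam ^ A.card ≤
        2 * Real.exp (-(κ * h ^ 3)) *
          ∑ A with ((H.filter (· ⊆ A)).card : ℝ) ≤ T, lam ^ A.card := by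
  have hz0 : 0 ≤ zetaOf c x₁ := zetaOf_nonneg hx₁ hx₁c
  obtain ⟨κ, hκ, τ, hτ, h₀, hh₀, key⟩ := exists_linear_bound hc hz0 hζ1 hζc hκ₀
  rcases hx₁η with hlt | ⟨rfl, hone⟩
  · have hx₁0 : 0 ≤ triDensity c x₁ := mul_nonneg (by linarith) (by positivity)
    have hη0 : 0 < η := hx₁0.trans_lt hlt
    set D := c ^ 3 * Real.log (2 / η) with hD
    have hlogη : 0 < Real.log (2 / η) := Real.log_pos ((one_lt_div hη0).2 (by linarith))
    have hD0 : 0 < D := by positivity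
    set ω := min ((η - triDensity c x₁) / 2) (κ / 2 / D) with hω
    have hω0 : 0 < ω := lt_min (by linarith) (by positivity)
    have hω2 : ω ≤ (η - triDensity c x₁) / 2 := min_le_left _ _
    have hω1 : ω ≤ η := by linarith
    have hω3 : ω * D ≤ κ / 2 := by
      rw [← le_div_iff₀ hD0]
      exact min_le_right _ _
    obtain ⟨x, hx1x, hxc, hdx, hr0, τ', hτ', h₁, hh₁, win⟩ :=
      exists_window_mass hc hx₁ hx₁c hζ1 hζc hη1 hω0 (by linarith)
    have hx := hx₁.trans_le hx1x
    refine ⟨κ / 2, by positivity, min τ τ', by positivity, max h₀ h₁, lt_max_of_lt_left hh₀, ?_⟩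
    intro E _ _ lam H d h T y hlam hH hh hhd hlc hHl hHu _ hT hy hysum hE
    have hhh₀ : h₀ ≤ h := (le_max_left _ _).trans hh
    have hhp : 0 < h := hh₀.trans_le hhh₀
    have hQ0 : 0 ≤ (H.card : ℝ) / h ^ 3 := by positivity
    have win := win E lam H d h T hlam hH ((le_max_right _ _).trans hh) hhd
      (hlc.trans (min_le_right _ _)) hHl
      (hT.trans (mul_le_mul_of_nonneg_right (min_le_right _ _) hQ0))
    have hzx : zetaOf c x ≤ zetaOf c x₁ := by
      rcases hx1x.eq_or_lt with rfl | h1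
      · exact le_rfl
      · exact (zetaOf_lt hx₁ h1 hxc).le
    have hzx0 : 0 ≤ zetaOf c x := zetaOf_nonneg hx hxc
    set r := 1 - zetaOf c x with hr
    have hr1 : r ≤ 1 := by linarith
    have hrη : η / 2 ≤ r := by
      have h1 : r * (x / c) ^ 3 = η - ω / 2 := by rw [← hdx]; rfl
      have h2 : (x / c) ^ 3 ≤ 1 := pow_le_one₀ (by positivity) ((div_le_one hc).2 hxc)
      have h3 : r * (x / c) ^ 3 ≤ r := mul_le_of_le_one_right hr0.le h2
      linarith
    have lin := key E lam r H d h x y hlam hr0.le hr1 (by linarith) hH hhh₀ hhd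
      (hlc.trans (min_le_left _ _)) hx.le
      (by rw [hr, sub_sub_cancel]; exact fixedPoint_zetaOf hc hx) hy hysum hE
    set Q := (H.card : ℝ) / h ^ 3 with hQ
    have hQh : Q ≤ h ^ 3 := by
      rw [hQ, div_le_iff₀ (by positivity)]
      calc (H.card : ℝ) ≤ h ^ 6 := hHu
        _ = _ := by ring
    set l := Real.log r with hl
    have hl0 : l ≤ 0 := Real.log_nonpos hr0.le hr1
    have hlη : -l ≤ Real.log (2 / η) := by
      rw [hl, ← Real.log_inv]
      refine Real.log_le_log (by positivity) ?_
      rw [inv_le_comm₀ hr0 (by positivity), inv_div]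
      exact hrη
    have hw : ∀ A : Finset E, triWeight (fun _ => lam) r H A =
        lam ^ A.card * Real.exp ((H.filter (· ⊆ A)).card * l) := by
      intro A
      rw [Real.exp_nat_mul, hl, Real.exp_log hr0, triWeight, Finset.prod_const]
    set Z := ∑ A, triWeight (fun _ => lam) r H A
    set B := ∑ A with ((H.filter (· ⊆ A)).card : ℝ) ≤ T, lam ^ A.card
    have hB0 : 0 ≤ B := Finset.sum_nonneg fun A _ => pow_nonneg hlam _
    have s1 : Real.exp (T * l) * ∑ A with 0 ≤ ∑ e ∈ A, y e ∧ ((H.filter (· ⊆ A)).card : ℝ) ≤ T,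
        lam ^ A.card ≤ Z * Real.exp (-(κ * h ^ 3)) := by
      refine le_trans ?_ lin
      rw [Finset.mul_sum]
      refine (Finset.sum_le_sum fun A hA => ?_).trans (Finset.sum_le_sum_of_subset_of_nonneg
        (Finset.monotone_filter_right _ fun A _ hA => hA.1) fun A _ _ =>
          triWeight_nonneg (fun _ => hlam) hr0.le H A)
      rw [hw, mul_comm]
      refine mul_le_mul_of_nonneg_left (Real.exp_le_exp.2 ?_) (pow_nonneg hlam _)
      exact mul_le_mul_of_nonpos_right (Finset.mem_filter.1 hA).2.2 hl0
    have s2 : Z / 2 ≤ Real.exp ((T - ω * c ^ 3 * Q) * l) * B := by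
      refine win.trans ?_
      rw [Finset.mul_sum]
      refine (Finset.sum_le_sum fun A hA => ?_).trans (Finset.sum_le_sum_of_subset_of_nonneg
        (Finset.monotone_filter_right _ fun A _ hA => hA.2) fun A _ _ =>
          mul_nonneg (Real.exp_pos _).le (pow_nonneg hlam _))
      rw [hw, mul_comm]
      refine mul_le_mul_of_nonneg_right (Real.exp_le_exp.2 ?_) (pow_nonneg hlam _)
      exact mul_le_mul_of_nonpos_right (Finset.mem_filter.1 hA).2.1 hl0
    set N := ∑ A with 0 ≤ ∑ e ∈ A, y e ∧ ((H.filter (· ⊆ A)).card : ℝ) ≤ T, lam ^ A.card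
    have s3 : Real.exp (T * l) * N ≤
        Real.exp (T * l) * (2 * Real.exp (-(κ / 2 * h ^ 3)) * B) := by
      refine s1.trans ?_
      have h1 : Z * Real.exp (-(κ * h ^ 3)) ≤
          2 * (Real.exp ((T - ω * c ^ 3 * Q) * l) * B) * Real.exp (-(κ * h ^ 3)) :=
        mul_le_mul_of_nonneg_right (by linarith) (Real.exp_pos _).le
      refine h1.trans ?_
      have h2 : Real.exp ((T - ω * c ^ 3 * Q) * l) * Real.exp (-(κ * h ^ 3)) ≤
          Real.exp (T * l) * Real.exp (-(κ / 2 * h ^ 3)) := by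
        rw [← Real.exp_add, ← Real.exp_add, Real.exp_le_exp]
        have h3 : ω * c ^ 3 * Q * -l ≤ κ / 2 * h ^ 3 :=
          calc ω * c ^ 3 * Q * -l ≤ ω * c ^ 3 * h ^ 3 * Real.log (2 / η) := by gcongr; linarith
            _ = ω * D * h ^ 3 := by rw [hD]; ring
            _ ≤ _ := by gcongr
        linarith
      calc _ = 2 * (Real.exp ((T - ω * c ^ 3 * Q) * l) * Real.exp (-(κ * h ^ 3))) * B := by ring
        _ ≤ 2 * (Real.exp (T * l) * Real.exp (-(κ / 2 * h ^ 3))) * B := by gcongr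
        _ = _ := by ring
    exact le_of_mul_le_mul_left s3 (Real.exp_pos _)
  · refine ⟨κ, hκ, τ, hτ, h₀, hh₀, ?_⟩
    intro E _ _ lam H d h T y hlam hH hh hhd hlc _ _ hT _ hy hysum hE
    have lin := key E lam 0 H d h x₁ y hlam le_rfl zero_le_one (by rw [hone, sub_zero]) hH hh hhd
      hlc hx₁.le (by
        have := fixedPoint_zetaOf hc hx₁
        rwa [hone, ← sub_zero (1:ℝ)] at this) hy hysum hE
    have hw : ∀ A : Finset E, triWeight (fun _ => lam) 0 H A =
        if ((H.filter (· ⊆ A)).card : ℝ) ≤ T then lam ^ A.card else 0 := by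
      intro A
      rw [hT rfl, triWeight, Finset.prod_const]
      rcases Nat.eq_zero_or_pos (H.filter (· ⊆ A)).card with h0 | h0
      · simp [h0]
      · have : ¬ ((H.filter (· ⊆ A)).card : ℝ) ≤ 0 := by
          rw [not_le]; exact_mod_cast h0
        rw [if_neg this, zero_pow h0.ne', mul_zero]
    simp only [hw] at lin
    rw [← Finset.sum_filter, ← Finset.sum_filter, Finset.filter_filter] at lin
    refine lin.trans ?_
    have : 0 ≤ (∑ A with ((H.filter (· ⊆ A)).card : ℝ) ≤ T, lam ^ A.card) *
        Real.exp (-(κ * h ^ 3)) :=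
      mul_nonneg (Finset.sum_nonneg fun A _ => pow_nonneg hlam _) (Real.exp_pos _).le
    linarith

lemma exists_fixedPoint {c : ℝ} (hc : 0 < c) : ∃ x, 0 < x ∧ x ≤ c ∧ zetaOf c x = 1 := by
  have hcont : ContinuousOn (fun x : ℝ => x - c * Real.exp (-x ^ 2)) (Set.Icc 0 c) := by fun_prop
  obtain ⟨x, hx, hx0⟩ := intermediate_value_Icc hc.le hcont (show (0:ℝ) ∈ _ from by
    refine ⟨by simp [hc.le], ?_⟩
    have : Real.exp (-c ^ 2) ≤ 1 := Real.exp_le_one_iff.2 (neg_nonpos.2 (sq_nonneg c))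
    nlinarith)
  have hxe : x = c * Real.exp (-x ^ 2) := sub_eq_zero.1 hx0
  have hxp : 0 < x := by rw [hxe]; positivity
  refine ⟨x, hxp, hx.2, ?_⟩
  have h1 : c / x = Real.exp (x ^ 2) := by
    rw [div_eq_iff hxp.ne']
    calc c = Real.exp (x ^ 2) * (c * Real.exp (-x ^ 2)) := by
          rw [mul_left_comm, ← Real.exp_add]
          simp
      _ = _ := by rw [← hxe]
  rw [zetaOf, h1, Real.log_exp, div_self (by positivity)]

lemma exists_threshold {W : ℝ → ℝ} (hW : IsLambertW W) {c η : ℝ} (hc : 0 < c) (hη : 0 ≤ η)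
    (hcbar : LtCbar W c η) :
    ∃ x₁, 0 < x₁ ∧ x₁ ≤ c ∧ zetaOf c x₁ ≤ 1 ∧ 2 * zetaOf c x₁ * c ^ 2 < 1 ∧
      (triDensity c x₁ < η ∨ (η = 0 ∧ zetaOf c x₁ = 1)) := by
  have he : 2 < Real.exp 1 := by linarith [Real.exp_one_gt_d9]
  have he0 : 0 < Real.exp 1 := Real.exp_pos 1
  rcases le_or_gt (Real.exp 1 * c ^ 2) 1 with hec | hec
  · obtain ⟨x, hx, hxc, hz⟩ := exists_fixedPoint hc
    refine ⟨x, hx, hxc, hz.le, ?_, ?_⟩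
    · rw [hz]
      have : 0 < c ^ 2 := by positivity
      nlinarith
    · rcases hη.eq_or_lt with h0 | h0
      · exact Or.inr ⟨h0.symm, hz⟩
      · left
        simpa [triDensity, hz] using h0
  · obtain ⟨hw0, hwe, -⟩ := hW (2 / Real.exp 1) (by positivity)
    set w := W (2 / Real.exp 1) with hw
    have hwp : 0 < w := by
      refine lt_of_le_of_ne hw0 fun h => ?_
      rw [← h, zero_mul] at hwe
      have : 0 < 2 / Real.exp 1 := by positivity
      exact this.ne hwe
    have hstar : etaStar W = Real.exp (-w / 2) ^ 3 := by
      have h1 : w / (2 / Real.exp 1) = Real.exp (-w) := by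
        rw [← hwe, Real.exp_neg]
        field_simp
      rw [etaStar, ← hw, h1, ← Real.exp_mul, ← Real.exp_nat_mul]
      congr 1
      push_cast
      ring
    have hstar0 : 0 < etaStar W := by rw [hstar]; positivity
    have hdiv : c / (c * Real.exp (-w / 2)) = Real.exp (w / 2) := by
      rw [neg_div, Real.exp_neg]
      field_simp
    have hz : zetaOf c (c * Real.exp (-w / 2)) = 1 / (Real.exp 1 * c ^ 2) := by
      have h1 : Real.exp (-w / 2) ^ 2 * Real.exp w = 1 := by
        rw [← Real.exp_nat_mul, ← Real.exp_add]
        simp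
        ring_nf
      have h2 : w * Real.exp w * Real.exp 1 = 2 := by rw [hwe]; field_simp
      rw [zetaOf, hdiv, Real.log_exp, div_eq_div_iff (by positivity) (by positivity)]
      calc w / 2 * (Real.exp 1 * c ^ 2) = w / 2 * (Real.exp 1 * c ^ 2) *
            (Real.exp (-w / 2) ^ 2 * Real.exp w) := by rw [h1, mul_one]
        _ = w * Real.exp w * Real.exp 1 / 2 * (c * Real.exp (-w / 2)) ^ 2 := by ring
        _ = _ := by rw [h2]; ring
    have hd : triDensity c (c * Real.exp (-w / 2)) =
        (1 - 1 / (Real.exp 1 * c ^ 2)) * etaStar W := by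
      rw [triDensity, hz, hstar, mul_div_cancel_left₀ _ hc.ne']
    refine ⟨c * Real.exp (-w / 2), by positivity, ?_, ?_, ?_, Or.inl ?_⟩
    · exact mul_le_of_le_one_right hc.le (Real.exp_le_one_iff.2 (by linarith))
    · rw [hz, div_le_one (by positivity)]
      exact hec.le
    · rw [hz]
      have : 2 * (1 / (Real.exp 1 * c ^ 2)) * c ^ 2 = 2 / Real.exp 1 := by field_simp
      rw [this, div_lt_one he0]
      exact he
    · rw [hd]
      have hpos : 0 < 1 / (Real.exp 1 * c ^ 2) := by positivity
      rcases lt_or_ge η (etaStar W) with hlt | hge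
      · have h1 := hcbar hlt
        have h2 : 0 < 1 - η / etaStar W := by
          rw [sub_pos, div_lt_one hstar0]; exact hlt
        have h3 : 0 < Real.exp 1 * (1 - η / etaStar W) := by positivity
        rw [lt_div_iff₀ (Real.sqrt_pos.2 h3)] at h1
        have h4 : (c * Real.sqrt (Real.exp 1 * (1 - η / etaStar W))) ^ 2 < 1 :=
          pow_lt_one₀ (by positivity) h1 two_ne_zero
        rw [mul_pow, Real.sq_sqrt h3.le] at h4
        have h5 : 1 - η / etaStar W < 1 / (Real.exp 1 * c ^ 2) := by
          rw [lt_div_iff₀ (by positivity)]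
          linarith
        have h6 : 1 - 1 / (Real.exp 1 * c ^ 2) < η / etaStar W := by linarith
        rwa [lt_div_iff₀ hstar0] at h6
      · nlinarith

section CompleteGraph

variable {n : ℕ}

/-- The edges of the complete graph on `Fin n`. -/
abbrev Edge (n : ℕ) : Type := {e : Sym2 (Fin n) // ¬ e.IsDiag}

/-- The edges of the complete graph contained in `s`. -/
def pairsIn (s : Finset (Fin n)) : Finset (Edge n) :=
  Finset.univ.filter fun e => ∀ v ∈ e.1, v ∈ s

/-- The edge sets of the triangles of the complete graph. -/
def triangles (n : ℕ) : Finset (Finset (Edge n)) :=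
  (Finset.powersetCard 3 Finset.univ).image pairsIn

/-- The edges of `G`, as a subset of the edges of the complete graph. -/
def edgesOf (G : SimpleGraph (Fin n)) : Finset (Edge n) :=
  Finset.univ.filter fun e => e.1 ∈ G.edgeSet

/-- `e` has exactly one endpoint in `S`. -/
def Crosses (S : Finset (Fin n)) (e : Edge n) : Prop := ∃ u ∈ S, ∃ v ∉ S, e.1 = s(u, v)

lemma mem_pairsIn {s : Finset (Fin n)} {e : Edge n} : e ∈ pairsIn s ↔ ∀ v ∈ e.1, v ∈ s := by
  simp [pairsIn]

lemma mem_edgesOf {G : SimpleGraph (Fin n)} {e : Edge n} : e ∈ edgesOf G ↔ e.1 ∈ G.edgeSet := by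
  simp [edgesOf]

lemma card_pairsIn (s : Finset (Fin n)) : (pairsIn s).card = s.card.choose 2 := by
  rw [← Sym2.card_image_offDiag, ← Finset.card_map (Function.Embedding.subtype _)]
  congr 1
  ext e
  induction e with | _ u v
  simp only [Finset.mem_map, mem_pairsIn, Finset.mem_image, Finset.mem_offDiag, Prod.exists]
  constructor
  · rintro ⟨⟨e, he⟩, h1, rfl : e = s(u, v)⟩
    exact ⟨u, v, ⟨h1 u (by simp), h1 v (by simp), by simpa using he⟩, rfl⟩
  · rintro ⟨a, b, ⟨ha, hb, hab⟩, h⟩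
    have hs : s(a, b) = s(u, v) := h
    refine ⟨⟨s(u, v), by rw [← hs]; simpa using hab⟩, fun w hw => ?_, rfl⟩
    have hw' : w ∈ s(a, b) := hs ▸ hw
    rcases Sym2.mem_iff.1 hw' with rfl | rfl <;> assumption

lemma eq_of_two_edges {s t : Finset (Fin n)} (hs : s.card = 3) (ht : t.card = 3) {a b : Edge n}
    (hab : a ≠ b) (has : a ∈ pairsIn s) (hbs : b ∈ pairsIn s) (hat : a ∈ pairsIn t)
    (hbt : b ∈ pairsIn t) : s = t := by
  rw [mem_pairsIn] at has hbs hat hbt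
  set w := a.1.toFinset ∪ b.1.toFinset with hw
  have hsub : ∀ {q : Finset (Fin n)}, (∀ v ∈ a.1, v ∈ q) → (∀ v ∈ b.1, v ∈ q) → w ⊆ q := by
    intro q h1 h2 v hv
    rcases Finset.mem_union.1 hv with h | h
    · exact h1 v (by simpa using h)
    · exact h2 v (by simpa using h)
  have hca := Sym2.card_toFinset_of_not_isDiag _ a.2
  have hcb := Sym2.card_toFinset_of_not_isDiag _ b.2
  have hcard : 3 ≤ w.card := by
    by_contra hlt
    have h1 : a.1.toFinset = w :=
      Finset.eq_of_subset_of_card_le Finset.subset_union_left (by omega)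
    have h2 : b.1.toFinset = w :=
      Finset.eq_of_subset_of_card_le Finset.subset_union_right (by omega)
    refine hab (Subtype.ext (Sym2.ext fun v => ?_))
    rw [← Sym2.mem_toFinset, ← Sym2.mem_toFinset, h1, h2]
  rw [← Finset.eq_of_subset_of_card_le (hsub has hbs) (by omega),
    ← Finset.eq_of_subset_of_card_le (hsub hat hbt) (by omega)]

lemma pairsIn_injOn : Set.InjOn (pairsIn (n := n)) {s | s.card = 3} := by
  intro s hs t ht hst
  have hc : 1 < (pairsIn s).card := by
    rw [card_pairsIn, hs]
    decide
  obtain ⟨a, ha, b, hb, hab⟩ := Finset.one_lt_card.1 hc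
  exact eq_of_two_edges hs ht hab ha hb (hst ▸ ha) (hst ▸ hb)

lemma card_triangles : (triangles n).card = n.choose 3 := by
  rw [triangles, Finset.card_image_of_injOn, Finset.card_powersetCard, Finset.card_univ,
    Fintype.card_fin]
  intro s hs t ht
  exact pairsIn_injOn (Finset.mem_powersetCard.1 hs).2 (Finset.mem_powersetCard.1 ht).2

lemma card_triangles_filter_mem (e : Edge n) :
    ((triangles n).filter (e ∈ ·)).card = n - 2 := by
  have hc := Sym2.card_toFinset_of_not_isDiag _ e.2
  have himg : (triangles n).filter (e ∈ ·) =
      (e.1.toFinset)ᶜ.image fun w => pairsIn (insert w e.1.toFinset) := by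
    ext t
    simp only [triangles, Finset.mem_filter, Finset.mem_image, Finset.mem_powersetCard,
      Finset.mem_compl]
    constructor
    · rintro ⟨⟨s, ⟨-, hs⟩, rfl⟩, he⟩
      have hsub : e.1.toFinset ⊆ s := fun v hv => mem_pairsIn.1 he v (by simpa using hv)
      have h1 : (s \ e.1.toFinset).card = 1 := by
        rw [Finset.card_sdiff_of_subset hsub]
        omega
      obtain ⟨w, hw⟩ := Finset.card_eq_one.1 h1
      refine ⟨w, (Finset.mem_sdiff.1 (hw ▸ Finset.mem_singleton_self w)).2, ?_⟩
      congr 1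
      rw [Finset.insert_eq, ← hw, Finset.sdiff_union_of_subset hsub]
    · rintro ⟨w, hw, rfl⟩
      refine ⟨⟨_, ⟨Finset.subset_univ _, ?_⟩, rfl⟩, ?_⟩
      · rw [Finset.card_insert_of_notMem hw, hc]
      · rw [mem_pairsIn]
        intro v hv
        exact Finset.mem_insert_of_mem (by simpa using hv)
  rw [himg, Finset.card_image_of_injOn, Finset.card_compl, hc, Fintype.card_fin]
  intro v hv w hw hvw
  have hv' : v ∉ e.1.toFinset := by simpa using hv
  have hw' : w ∉ e.1.toFinset := by simpa using hw
  have := pairsIn_injOn (by rw [Set.mem_ofPred_eq, Finset.card_insert_of_notMem hv', hc])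
    (by rw [Set.mem_ofPred_eq, Finset.card_insert_of_notMem hw', hc]) hvw
  have hmem : v ∈ insert w e.1.toFinset := this ▸ Finset.mem_insert_self _ _
  exact (Finset.mem_insert.1 hmem).resolve_right hv'

lemma isLinearTriple_triangles : IsLinearTriple (triangles n) (n - 2) where
  card_eq t ht := by
    obtain ⟨s, hs, rfl⟩ := Finset.mem_image.1 ht
    rw [card_pairsIn, (Finset.mem_powersetCard.1 hs).2]
    rfl
  linear s hs t ht a b hab has hbs hat hbt := by
    obtain ⟨s', hs', rfl⟩ := Finset.mem_image.1 hs
    obtain ⟨t', ht', rfl⟩ := Finset.mem_image.1 ht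
    rw [eq_of_two_edges (Finset.mem_powersetCard.1 hs').2 (Finset.mem_powersetCard.1 ht').2 hab
      has hbs hat hbt]
  degree := card_triangles_filter_mem

lemma card_edge : Fintype.card (Edge n) = n.choose 2 := by
  rw [Sym2.card_subtype_not_diag, Fintype.card_fin]

lemma edgesOf_bijective : Function.Bijective (edgesOf (n := n)) := by
  constructor
  · intro G G' h
    ext u v
    by_cases huv : u = v
    · simp [huv]
    · have := Finset.ext_iff.1 h ⟨s(u, v), by simpa using huv⟩
      simpa [mem_edgesOf] using this
  · intro A
    refine ⟨SimpleGraph.fromEdgeSet (Subtype.val '' (A : Set (Edge n))), ?_⟩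
    ext e
    rw [mem_edgesOf, SimpleGraph.edgeSet_fromEdgeSet]
    constructor
    · rintro ⟨⟨e', he', heq⟩, -⟩
      rwa [← Subtype.ext heq]
    · intro he
      exact ⟨⟨e, he, rfl⟩, e.2⟩

lemma edgeCount_eq (G : SimpleGraph (Fin n)) : edgeCount G = (edgesOf G).card := by
  rw [edgeCount, Nat.card_eq_fintype_card, ← SimpleGraph.edgeFinset_card,
    ← Finset.card_map (Function.Embedding.subtype _)]
  congr 1
  ext e
  simp only [SimpleGraph.mem_edgeFinset, Finset.mem_map, mem_edgesOf]
  constructor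
  · intro he
    exact ⟨⟨e, G.not_isDiag_of_mem_edgeSet he⟩, he, rfl⟩
  · rintro ⟨e, he, rfl⟩
    exact he

lemma pairsIn_subset_edgesOf {G : SimpleGraph (Fin n)} {s : Finset (Fin n)} :
    pairsIn s ⊆ edgesOf G ↔ G.IsClique s := by
  constructor
  · intro h u hu v hv huv
    have : (⟨s(u, v), by simpa using huv⟩ : Edge n) ∈ edgesOf G := by
      refine h (mem_pairsIn.2 fun w hw => ?_)
      rcases Sym2.mem_iff.1 hw with rfl | rfl <;> assumption
    simpa [mem_edgesOf] using this
  · rintro h ⟨e, he⟩ hes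
    rw [mem_pairsIn] at hes
    rw [mem_edgesOf]
    induction e with | _ u v
    exact h (hes u (by simp)) (hes v (by simp)) (by simpa using he)

lemma triCount_eq (G : SimpleGraph (Fin n)) :
    triCount G = ((triangles n).filter (· ⊆ edgesOf G)).card := by
  rw [triCount, Nat.card_eq_fintype_card, Fintype.card_subtype,
    ← Finset.card_image_of_injOn (f := pairsIn)]
  · congr 1
    ext t
    simp only [triangles, Finset.mem_image, Finset.mem_filter, Finset.mem_univ, true_and,
      Finset.mem_powersetCard, Finset.subset_univ, SimpleGraph.isNClique_iff]
    constructor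
    · rintro ⟨s, ⟨h1, h2⟩, rfl⟩
      exact ⟨⟨s, h2, rfl⟩, pairsIn_subset_edgesOf.2 h1⟩
    · rintro ⟨⟨s, h2, rfl⟩, h1⟩
      exact ⟨s, ⟨pairsIn_subset_edgesOf.1 h1, h2⟩, rfl⟩
  · intro s hs t ht
    exact pairsIn_injOn (Finset.mem_filter.1 hs).2.card_eq (Finset.mem_filter.1 ht).2.card_eq

lemma cutSize_eq (G : SimpleGraph (Fin n)) (S : Finset (Fin n)) :
    cutSize G S = ((edgesOf G).filter (Crosses S)).card := by
  rw [cutSize, Nat.card_eq_fintype_card, Fintype.card_subtype]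
  refine Finset.card_bij (fun q hq => ⟨s(q.1, q.2), ?_⟩) ?_ ?_ ?_
  · simpa using (Finset.mem_filter.1 hq).2.2.2.ne
  · intro q hq
    obtain ⟨-, h1, h2, h3⟩ := Finset.mem_filter.1 hq
    exact Finset.mem_filter.2 ⟨mem_edgesOf.2 h3, _, h1, _, h2, rfl⟩
  · rintro ⟨a, b⟩ hq ⟨a', b'⟩ hq' h
    obtain ⟨-, h1, h2, -⟩ := Finset.mem_filter.1 hq
    obtain ⟨-, h1', h2', -⟩ := Finset.mem_filter.1 hq'
    rcases Sym2.eq_iff.1 (congrArg Subtype.val h) with ⟨h3, h4⟩ | ⟨h3, h4⟩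
    · exact Prod.ext h3 h4
    · obtain rfl : a = b' := h3
      exact absurd h1 h2'
  · intro e he
    obtain ⟨h1, u, hu, v, hv, huv⟩ := Finset.mem_filter.1 he
    refine ⟨(u, v), Finset.mem_filter.2 ⟨Finset.mem_univ _, hu, hv, ?_⟩, Subtype.ext huv.symm⟩
    rwa [mem_edgesOf, huv] at h1

lemma card_crosses (S : Finset (Fin n)) :
    (Finset.univ.filter (Crosses S)).card = S.card * (n - S.card) := by
  have htop : edgesOf (⊤ : SimpleGraph (Fin n)) = Finset.univ := by
    ext e
    simpa [mem_edgesOf] using e.2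
  rw [← htop, ← cutSize_eq, cutSize, Nat.card_eq_fintype_card, Fintype.card_subtype]
  have hS : n - S.card = Sᶜ.card := by rw [Finset.card_compl, Fintype.card_fin]
  rw [hS, ← Finset.card_product]
  congr 1
  ext ⟨a, b⟩
  simp only [Finset.mem_filter, Finset.mem_univ, true_and, SimpleGraph.top_adj,
    Finset.mem_product, Finset.mem_compl]
  constructor
  · rintro ⟨h1, h2, -⟩
    exact ⟨h1, h2⟩
  · rintro ⟨h1, h2⟩
    exact ⟨h1, h2, ne_of_mem_of_not_mem h1 h2⟩

end CompleteGraph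

section RandomGraph

variable {n : ℕ}

lemma erProb_nonneg {p : ℝ} (hp : p ∈ Set.Ioo (0 : ℝ) 1) (X : Set (SimpleGraph (Fin n))) :
    0 ≤ erProb n p X := by
  refine Finset.sum_nonneg fun G _ => ?_
  have h1 : 0 ≤ 1 - p := by linarith [hp.2]
  have h0 : 0 ≤ p := hp.1.le
  split_ifs <;> positivity

lemma erProb_le_sum {p : ℝ} (hp : p ∈ Set.Ioo (0 : ℝ) 1) {ι : Type*} [Fintype ι]
    (X : Set (SimpleGraph (Fin n))) (Y : ι → Set (SimpleGraph (Fin n)))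
    (hXY : ∀ G ∈ X, ∃ i, G ∈ Y i) : erProb n p X ≤ ∑ i, erProb n p (Y i) := by
  unfold erProb
  rw [Finset.sum_comm]
  refine Finset.sum_le_sum fun G _ => ?_
  have h1 : 0 ≤ 1 - p := by linarith [hp.2]
  have h0 : 0 ≤ p := hp.1.le
  have hnn : ∀ i ∈ (Finset.univ : Finset ι), 0 ≤
      if G ∈ Y i then p ^ edgeCount G * (1 - p) ^ (n.choose 2 - edgeCount G) else 0 := by
    intro i _
    split_ifs <;> positivity
  split_ifs with hG
  · obtain ⟨i, hi⟩ := hXY G hG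
    refine le_trans ?_ (Finset.single_le_sum hnn (Finset.mem_univ i))
    rw [if_pos hi]
  · exact Finset.sum_nonneg hnn

lemma erProb_eq_sum_edges {p : ℝ} (hp : p ∈ Set.Ioo (0 : ℝ) 1) (X : Set (SimpleGraph (Fin n)))
    (Q : Finset (Edge n) → Prop) [DecidablePred Q] (hXQ : ∀ G, G ∈ X ↔ Q (edgesOf G)) :
    erProb n p X = (1 - p) ^ n.choose 2 * ∑ A with Q A, (p / (1 - p)) ^ A.card := by
  have h1 : 1 - p ≠ 0 := by linarith [hp.2]
  rw [Finset.sum_filter, Finset.mul_sum, erProb,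
    ← (Equiv.ofBijective _ (edgesOf_bijective (n := n))).sum_comp]
  refine Finset.sum_congr rfl fun G _ => ?_
  rw [Equiv.ofBijective_apply, edgeCount_eq]
  by_cases hG : G ∈ X
  · rw [if_pos hG, if_pos ((hXQ G).1 hG)]
    have hle : (edgesOf G).card ≤ n.choose 2 := card_edge (n := n) ▸ Finset.card_le_univ _
    rw [div_pow, ← Nat.sub_add_cancel hle, Nat.add_sub_cancel, pow_add]
    field_simp
  · rw [if_neg hG, if_neg (mt (hXQ G).2 hG), mul_zero]

/-- For `some S`, the excess over the density `1/2 + δ` of the cut `S`; for `none`, the deficit of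
the reference cut `S₀` below the density `1/2 - δ`. -/
def cutDeviation (δ : ℝ) (S₀ : Finset (Fin n)) : Option (Finset (Fin n)) → Edge n → ℝ
  | some S => fun e => (if Crosses S e then 1 else 0) - (1 / 2 + δ)
  | none => fun e => 1 / 2 - δ - if Crosses S₀ e then 1 else 0

lemma sum_cutDeviation_some (δ : ℝ) (S₀ S : Finset (Fin n)) (A : Finset (Edge n)) :
    ∑ e ∈ A, cutDeviation δ S₀ (some S) e =
      ((A.filter (Crosses S)).card : ℝ) - (1 / 2 + δ) * A.card := by
  simp only [cutDeviation, Finset.sum_sub_distrib, Finset.sum_boole, Finset.sum_const,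
    nsmul_eq_mul]
  ring

lemma sum_cutDeviation_none (δ : ℝ) (S₀ : Finset (Fin n)) (A : Finset (Edge n)) :
    ∑ e ∈ A, cutDeviation δ S₀ none e =
      (1 / 2 - δ) * A.card - ((A.filter (Crosses S₀)).card : ℝ) := by
  simp only [cutDeviation, Finset.sum_sub_distrib, Finset.sum_boole, Finset.sum_const,
    nsmul_eq_mul]
  ring

lemma abs_cutDeviation_le {δ : ℝ} (hδ : 0 ≤ δ) (hδ1 : δ ≤ 1 / 2) (S₀ : Finset (Fin n))
    (i : Option (Finset (Fin n))) (e : Edge n) : |cutDeviation δ S₀ i e| ≤ 1 := by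
  rw [abs_le]
  cases i <;> simp only [cutDeviation] <;> split_ifs <;> constructor <;> linarith

lemma exists_cutDeviation_nonneg {ε δ : ℝ} (hδε : δ ≤ ε) (S₀ : Finset (Fin n))
    (G : SimpleGraph (Fin n)) (hG : ε < |maxCutFrac G - 1 / 2|) :
    ∃ i, 0 ≤ ∑ e ∈ edgesOf G, cutDeviation δ S₀ i e := by
  by_cases h0 : edgeCount G = 0
  · refine ⟨none, ?_⟩
    rw [edgeCount_eq, Finset.card_eq_zero] at h0
    rw [h0, Finset.sum_empty]
  have hpos : 0 < (edgeCount G : ℝ) := by exact_mod_cast Nat.pos_of_ne_zero h0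
  rw [maxCutFrac, if_neg h0] at hG
  rcases lt_abs.1 hG with h | h
  · obtain ⟨S, -, hS⟩ := Finset.exists_mem_eq_sup Finset.univ Finset.univ_nonempty
      (fun S : Finset (Fin n) => cutSize G S)
    refine ⟨some S, ?_⟩
    rw [sum_cutDeviation_some, ← edgeCount_eq, ← cutSize_eq]
    rw [hS] at h
    have h' := (lt_div_iff₀ hpos).1 (show 1 / 2 + ε < (cutSize G S : ℝ) / edgeCount G by linarith)
    nlinarith
  · refine ⟨none, ?_⟩
    rw [sum_cutDeviation_none, ← edgeCount_eq, ← cutSize_eq]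
    have hle : (cutSize G S₀ : ℝ) ≤
        ((Finset.univ.sup (fun S : Finset (Fin n) => cutSize G S) : ℕ) : ℝ) := by
      exact_mod_cast Finset.le_sup (f := fun S : Finset (Fin n) => cutSize G S)
        (Finset.mem_univ S₀)
    have h' := (div_lt_iff₀ hpos).1 (show ((Finset.univ.sup
      (fun S : Finset (Fin n) => cutSize G S) : ℕ) : ℝ) / edgeCount G < 1 / 2 - ε by linarith)
    nlinarith

lemma sum_cutDeviation_univ_le {δ : ℝ} (hδ : 0 < δ) (hδ1 : δ ≤ 1 / 2) (hn : 2 / δ ≤ n)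
    (S₀ : Finset (Fin n)) (hS₀ : S₀.card = n / 2) (i : Option (Finset (Fin n))) :
    ∑ e, cutDeviation δ S₀ i e ≤ -(δ / 8 * (n : ℝ) ^ 2) := by
  have hn' : 2 ≤ (n : ℝ) * δ := (div_le_iff₀ hδ).1 hn
  have hn2 : (4 : ℝ) ≤ n := by nlinarith
  have hN : ((n.choose 2 : ℕ) : ℝ) = n * (n - 1) / 2 := Nat.cast_choose_two ℝ n
  have hsq : (n : ℝ) * 2 ≤ n * (n * δ) := by gcongr
  cases i with
  | some S =>
    rw [sum_cutDeviation_some, card_crosses, Finset.card_univ, card_edge, hN, Nat.cast_mul,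
      Nat.cast_sub (by simpa using Finset.card_le_univ S)]
    have h4 : (S.card : ℝ) * (n - S.card) ≤ (n : ℝ) ^ 2 / 4 := by
      nlinarith [sq_nonneg ((n : ℝ) - 2 * S.card)]
    nlinarith
  | none =>
    rw [sum_cutDeviation_none, card_crosses, Finset.card_univ, card_edge, hN, Nat.cast_mul,
      Nat.cast_sub (by simpa using Finset.card_le_univ S₀), hS₀]
    have h4 : ((n : ℝ) ^ 2 - 1) / 4 ≤ ((n / 2 : ℕ) : ℝ) * (n - (n / 2 : ℕ)) := by
      have hb1 : ((n / 2 : ℕ) : ℝ) * 2 ≤ n := by exact_mod_cast Nat.div_mul_le_self n 2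
      have hb2 : (n : ℝ) ≤ ((n / 2 : ℕ) : ℝ) * 2 + 1 := by
        have : n ≤ n / 2 * 2 + 1 := by omega
        exact_mod_cast this
      nlinarith
    nlinarith

lemma choose_three_bounds (hn : 6 ≤ n) :
    (n : ℝ) ^ 3 / 12 ≤ (n.choose 3 : ℝ) ∧ (n.choose 3 : ℝ) ≤ (n : ℝ) ^ 3 := by
  constructor
  · obtain ⟨m, rfl⟩ := Nat.exists_eq_add_of_le' (show 2 ≤ n by omega)
    have h2 : (((m + 2).choose 3 : ℕ) : ℝ) * 6 = (m + 2 : ℝ) * (m + 1) * m := by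
      have := Nat.descFactorial_eq_factorial_mul_choose (m + 2) 3
      have h3 : (m + 2).descFactorial 3 = (m + 2) * (m + 1) * m := by
        simp [Nat.descFactorial]
        ring
      rw [h3] at this
      have h4 := congrArg (Nat.cast (R := ℝ)) this
      push_cast [Nat.factorial] at h4
      linarith
    have hm : (4 : ℝ) ≤ m := by exact_mod_cast (show 4 ≤ m by omega)
    push_cast
    nlinarith [mul_nonneg (by linarith : (0 : ℝ) ≤ m) (by linarith : (0 : ℝ) ≤ (m : ℝ) - 4)]
  · exact_mod_cast Nat.choose_le_pow n 3

lemma erCondProb_maxCut_le {p ε δ q T : ℝ} (hp : p ∈ Set.Ioo (0 : ℝ) 1) (hδε : δ ≤ ε)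
    (S₀ : Finset (Fin n)) (hq₀ : 0 ≤ q)
    (hq : ∀ i : Option (Finset (Fin n)),
      ∑ A with 0 ≤ ∑ e ∈ A, cutDeviation δ S₀ i e ∧
        (((triangles n).filter (· ⊆ A)).card : ℝ) ≤ T, (p / (1 - p)) ^ A.card ≤
      q * ∑ A : Finset (Edge n) with (((triangles n).filter (· ⊆ A)).card : ℝ) ≤ T,
        (p / (1 - p)) ^ A.card) :
    erCondProb n p {G | ε < |maxCutFrac G - 1 / 2|} {G | (triCount G : ℝ) ≤ T} ≤
      (2 ^ n + 1) * q := by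
  set B : Set (SimpleGraph (Fin n)) := {G | (triCount G : ℝ) ≤ T} with hB
  have hBeq := erProb_eq_sum_edges hp B
    (fun A => (((triangles n).filter (· ⊆ A)).card : ℝ) ≤ T) fun G => by
      rw [hB, Set.mem_ofPred_eq, triCount_eq]
  refine div_le_of_le_mul₀ (erProb_nonneg hp _) (by positivity) ?_
  refine (erProb_le_sum hp _ (fun i : Option (Finset (Fin n)) =>
    {G | 0 ≤ ∑ e ∈ edgesOf G, cutDeviation δ S₀ i e ∧ (triCount G : ℝ) ≤ T}) ?_).trans ?_
  · rintro G ⟨h1, h2⟩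
    obtain ⟨i, hi⟩ := exists_cutDeviation_nonneg hδε S₀ G h1
    exact ⟨i, hi, h2⟩
  · have hone : ∀ i ∈ (Finset.univ : Finset (Option (Finset (Fin n)))), erProb n p
        {G | 0 ≤ ∑ e ∈ edgesOf G, cutDeviation δ S₀ i e ∧ (triCount G : ℝ) ≤ T} ≤
        q * erProb n p B := by
      intro i _
      rw [hBeq, erProb_eq_sum_edges hp _
        (fun A => 0 ≤ ∑ e ∈ A, cutDeviation δ S₀ i e ∧
          (((triangles n).filter (· ⊆ A)).card : ℝ) ≤ T) fun G => by
            rw [Set.mem_ofPred_eq, triCount_eq]]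
      rw [mul_left_comm]
      refine mul_le_mul_of_nonneg_left (hq i) ?_
      have h1 : 0 ≤ 1 - p := by linarith [hp.2]
      positivity
    refine (Finset.sum_le_card_nsmul _ _ _ hone).trans ?_
    rw [Finset.card_univ, Fintype.card_option, Fintype.card_finset, Fintype.card_fin, nsmul_eq_mul]
    push_cast
    rw [← mul_assoc]

end RandomGraph

lemma tendsto_nhds_zero_of_sqrt_mul {p : ℕ → ℝ} {c : ℝ}
    (hpc : Tendsto (fun n : ℕ => Real.sqrt n * p n) atTop (nhds c)) :
    Tendsto p atTop (nhds 0) := by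
  have hsqrt : Tendsto (fun n : ℕ => Real.sqrt n) atTop atTop :=
    Real.tendsto_sqrt_atTop.comp tendsto_natCast_atTop_atTop
  have h := hpc.mul (tendsto_inv_atTop_zero.comp hsqrt)
  rw [mul_zero] at h
  refine h.congr' ?_
  filter_upwards [hsqrt.eventually_gt_atTop 0] with n hn
  simp only [Function.comp]
  field_simp

lemma union_bound_exp_le {n : ℕ} {κ h : ℝ} (hh : h ^ 2 = n) (hκh : 2 ≤ κ * h) :
    (2 ^ n + 1) * (2 * Real.exp (-(κ * h ^ 3))) ≤ 4 * Real.exp (-(n : ℝ)) := by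
  have h1 : κ * h ^ 3 = (κ * h) * n := by rw [← hh]; ring
  have hn : (0 : ℝ) ≤ n := Nat.cast_nonneg n
  have h2 : (2 : ℝ) ^ n ≤ Real.exp n := by
    rw [← Real.exp_one_pow]
    exact pow_le_pow_left₀ (by norm_num) (by linarith [Real.exp_one_gt_d9]) n
  have h3 : Real.exp (-(κ * h ^ 3)) ≤ Real.exp (-(n : ℝ)) * Real.exp (-(n : ℝ)) := by
    rw [← Real.exp_add, Real.exp_le_exp, h1]
    nlinarith
  have h4 : Real.exp (n : ℝ) * Real.exp (-(n : ℝ)) = 1 := by rw [← Real.exp_add]; simp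
  have h5 : (1 : ℝ) ≤ Real.exp n := Real.one_le_exp hn
  calc (2 ^ n + 1) * (2 * Real.exp (-(κ * h ^ 3)))
      ≤ (2 * Real.exp n) * (2 * (Real.exp (-(n : ℝ)) * Real.exp (-(n : ℝ)))) := by
        gcongr
        linarith
    _ = 4 * (Real.exp n * Real.exp (-(n : ℝ))) * Real.exp (-(n : ℝ)) := by ring
    _ = 4 * Real.exp (-(n : ℝ)) := by rw [h4, mul_one]

/-- **Corollary (max-cut fraction of the lower-tail conditional distribution).**
Conditioned on the lower-tail event, whp `MC(G) = 1/2 + o(1)`. -/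
theorem lower_tail_max_cut
    (W : ℝ → ℝ) (hW : IsLambertW W)
    (c η : ℝ) (hc : 0 < c) (hη : η ∈ Set.Ico (0 : ℝ) 1) (hcbar : LtCbar W c η)
    (p : ℕ → ℝ) (hp : ∀ n, p n ∈ Set.Ioo (0 : ℝ) 1)
    (hpc : Tendsto (fun n : ℕ => Real.sqrt n * p n) atTop (nhds c))
    (ε : ℝ) (hε : 0 < ε) :
    Tendsto (fun n : ℕ =>
        erCondProb n (p n)
          {G | ε < |maxCutFrac G - 1 / 2|}
          {G | (triCount G : ℝ) ≤ η * (n.choose 3 : ℝ) * p n ^ 3})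
      atTop (nhds 0) := by
  obtain ⟨x₁, hx₁, hx₁c, hζ1, hζc, hx₁η⟩ := exists_threshold hW hc hη.1 hcbar
  obtain ⟨δ, hδ, hδε, hδ1⟩ : ∃ δ : ℝ, 0 < δ ∧ δ ≤ ε ∧ δ ≤ 1 / 2 :=
    ⟨min ε (1 / 2), lt_min hε (by norm_num), min_le_left _ _, min_le_right _ _⟩
  obtain ⟨κ, hκ, τ, hτ, h₀, hh₀, key⟩ := exists_conditional_bound hc hx₁ hx₁c hζ1 hζc hη.1 hη.2
    hx₁η (show 0 < δ / 8 by positivity)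
  have hsqrt : Tendsto (fun n : ℕ => Real.sqrt n) atTop atTop :=
    Real.tendsto_sqrt_atTop.comp tendsto_natCast_atTop_atTop
  have hp0 := tendsto_nhds_zero_of_sqrt_mul hpc
  have hlam : Tendsto (fun n : ℕ => Real.sqrt n * (p n / (1 - p n))) atTop (nhds c) := by
    have h := hpc.div (tendsto_const_nhds.sub hp0) (show (1 : ℝ) - 0 ≠ 0 by norm_num)
    simp only [sub_zero, div_one] at h
    exact h.congr fun n => (mul_div_assoc _ _ _)
  have hcube : Tendsto (fun n : ℕ => η * (Real.sqrt n * p n) ^ 3) atTop (nhds (η * c ^ 3)) :=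
    (hpc.pow 3).const_mul η
  have hlim : Tendsto (fun n : ℕ => 4 * Real.exp (-(n : ℝ))) atTop (nhds 0) := by
    have h := (Real.tendsto_exp_neg_atTop_nhds_zero.comp
      (tendsto_natCast_atTop_atTop (R := ℝ))).const_mul 4
    rwa [mul_zero] at h
  refine tendsto_of_tendsto_of_tendsto_of_le_of_le' tendsto_const_nhds hlim
    (Eventually.of_forall fun n => div_nonneg (erProb_nonneg (hp n) _) (erProb_nonneg (hp n) _)) ?_
  filter_upwards [eventually_ge_atTop 6, hsqrt.eventually_ge_atTop h₀,
    hsqrt.eventually_ge_atTop (2 / κ), Metric.tendsto_nhds.1 hlam τ hτ,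
    Metric.tendsto_nhds.1 hcube τ hτ,
    (tendsto_natCast_atTop_atTop (R := ℝ)).eventually_ge_atTop (2 / δ)]
    with n hn6 hnh₀ hnκ hnlam hncube hnδ
  have hsq : Real.sqrt n ^ 2 = n := Real.sq_sqrt (Nat.cast_nonneg n)
  have hpos : 0 < Real.sqrt n := hh₀.trans_le hnh₀
  generalize Real.sqrt n = h at *
  have h4 : h ^ 4 = (n : ℝ) ^ 2 := by rw [← hsq]; ring
  have h6 : h ^ 6 = (n : ℝ) ^ 3 := by rw [← hsq]; ring
  obtain ⟨S₀, -, hS₀⟩ := Finset.exists_subset_card_eq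
    (show n / 2 ≤ (Finset.univ : Finset (Fin n)).card by
      rw [Finset.card_univ, Fintype.card_fin]; exact Nat.div_le_self n 2)
  obtain ⟨hb1, hb2⟩ := choose_three_bounds hn6
  refine (erCondProb_maxCut_le (hp n) hδε S₀ (q := 2 * Real.exp (-(κ * h ^ 3))) (by positivity)
    fun i => ?_).trans (union_bound_exp_le hsq ?_)
  · refine key (Edge n) (p n / (1 - p n)) (triangles n) (n - 2) h _ (cutDeviation δ S₀ i)
      ?_ isLinearTriple_triangles hnh₀ ?_ ?_ ?_ ?_ ?_ ?_
      (abs_cutDeviation_le hδ.le hδ1 S₀ i) ?_ ?_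
    · exact div_nonneg (hp n).1.le (by linarith [(hp n).2])
    · rw [hsq, Nat.cast_sub (by omega)]
      push_cast
      ring
    · exact (Real.dist_eq _ _ ▸ hnlam).le
    · rwa [card_triangles, h6]
    · rwa [card_triangles, h6]
    · intro h0
      rw [h0]
      ring
    · rw [card_triangles]
      have heq : η * (n.choose 3 : ℝ) * p n ^ 3 - η * c ^ 3 * ((n.choose 3 : ℝ) / h ^ 3) =
          (η * (h * p n) ^ 3 - η * c ^ 3) * ((n.choose 3 : ℝ) / h ^ 3) := by
        field_simp
      rw [heq, abs_mul, abs_of_nonneg (by positivity : 0 ≤ (n.choose 3 : ℝ) / h ^ 3)]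
      exact mul_le_mul_of_nonneg_right (Real.dist_eq _ _ ▸ hncube).le (by positivity)
    · rw [h4]
      exact sum_cutDeviation_univ_le hδ hδ1 hnδ S₀ hS₀ i
    · rw [h4, card_edge]
      exact_mod_cast Nat.choose_le_pow n 2
  · rw [mul_comm]
    exact (div_le_iff₀ hκ).1 hnκ
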